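/- arXiv:0712.2946 — 2 statements merged into one kernel-verified Lean document; each statement's English description precedes it below -/
import Mathlib

section
/- Let T be an ℝ-tree with a very small, minimal, isometric action of the free group F_N (N ≥ 2) with dense orbits and let 𝒜 be a basis of F_N. Let 𝒦_𝒜 = (K_𝒜, 𝒜) be the system of isometries induced on the heart K_𝒜 of T with respect to 𝒜. Then the canonical F_N-equivariant morphism j : T_{𝒦_𝒜} → T̄ is an isometric embedding, and its image contains T. -/
/-!
Common formalization framework for "ℝ-trees, dual laminations, and compact systems
of partial isometries" (Coulbois–Hilion–Lustig).
-/

open Set Filter Topology Pointwise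

noncomputable section

namespace CHL

/-! ### ℝ-trees -/

/-- The metric betweenness segment `[x,y]`.  In an ℝ-tree this is exactly the unique
topological arc joining `x` to `y`, which is a geodesic segment. -/
def seg {T : Type*} [MetricSpace T] (x y : T) : Set T :=
  {z | dist x z + dist z y = dist x y}

/-- An ℝ-tree: a geodesic metric space which is `0`-hyperbolic (four point condition).
Equivalently, any two points are joined by a unique topological arc, and this arc is a
geodesic segment. -/
class IsRTree (T : Type*) [MetricSpace T] : Prop where
  geodesic : ∀ x y : T, ∃ f : ℝ → T, f 0 = x ∧ f (dist x y) = y ∧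
      ∀ s ∈ Set.Icc (0 : ℝ) (dist x y), ∀ t ∈ Set.Icc (0 : ℝ) (dist x y),
        dist (f s) (f t) = |s - t|
  four_point : ∀ x y z w : T,
      dist x y + dist z w ≤ max (dist x z + dist y w) (dist x w + dist y z)

/-- A subtree of an ℝ-tree: a convex subset. -/
def IsSubtree {T : Type*} [MetricSpace T] (A : Set T) : Prop :=
  ∀ x ∈ A, ∀ y ∈ A, seg x y ⊆ A

/-- A non-empty closed subtree. -/
def IsClosedSubtree {T : Type*} [MetricSpace T] (A : Set T) : Prop :=
  A.Nonempty ∧ IsClosed A ∧ IsSubtree A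

/-- The convex hull of a subset of an ℝ-tree: the smallest subtree containing it. -/
def subtreeHull {T : Type*} [MetricSpace T] (S : Set T) : Set T :=
  ⋂₀ {A : Set T | S ⊆ A ∧ IsSubtree A}

/-- A finite tree: the convex hull of finitely many points. -/
def IsFiniteSubtree {T : Type*} [MetricSpace T] (A : Set T) : Prop :=
  ∃ F : Finset T, A = subtreeHull (F : Set T)

/-- `[x,x']` is the segment joining `A` to `B`: its endpoints are the only points
in `A` resp. `B` that it meets. -/
def IsBridge {T : Type*} [MetricSpace T] (A B : Set T) (x x' : T) : Prop :=
  x ∈ A ∧ x' ∈ B ∧ seg x x' ∩ A = {x} ∧ seg x x' ∩ B = {x'}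

/-- A morphism of ℝ-trees: a continuous map such that every segment is mapped locally
injectively except at finitely many points. -/
def IsTreeMorphism {T T' : Type*} [MetricSpace T] [MetricSpace T'] (f : T → T') : Prop :=
  Continuous f ∧ ∀ x y : T, ∃ F : Finset T, ∀ p ∈ seg x y, p ∉ (F : Set T) →
    ∃ U ∈ nhdsWithin p (seg x y), Set.InjOn f U

/-- The translation length `‖g‖_T = inf_{x ∈ T} d(x, gx)`. -/
def translationLength (G : Type*) [Group G] (T : Type*) [MetricSpace T] [MulAction G T]
    (g : G) : ℝ :=
  ⨅ x : T, dist x (g • x)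

/-- The translation length of `g` on an invariant subtree `A`. -/
def translationLengthOn {G : Type*} [Group G] {T : Type*} [MetricSpace T] [MulAction G T]
    (A : Set T) (g : G) : ℝ :=
  ⨅ x : A, dist (x : T) (g • (x : T))

/-- The minimal `G`-invariant subtree. -/
def minSubtree (G : Type*) [Group G] (T : Type*) [MetricSpace T] [MulAction G T] : Set T :=
  ⋂₀ {A : Set T | A.Nonempty ∧ IsSubtree A ∧ ∀ g : G, ∀ x ∈ A, g • x ∈ A}

/-! ### Free groups, reduced words and the boundary `∂F(𝒜)` -/

/-- Two letters of `𝒜^{±1}` are inverse to each other. -/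
def LettersInv {ι : Type*} (a b : ι × Bool) : Prop := a.1 = b.1 ∧ a.2 = !b.2

/-- The prefix of length `n` of (the reduced word of) `w`. -/
def gprefix {ι : Type*} [DecidableEq ι] (w : FreeGroup ι) (n : ℕ) : FreeGroup ι :=
  FreeGroup.mk (w.toWord.take n)

/-- An infinite reduced word in the letters `𝒜^{±1}`: a point of the Gromov boundary
`∂F(𝒜)` of the free group `F(𝒜)`. -/
structure InfWord (ι : Type*) where
  letter : ℕ → ι × Bool
  reduced : ∀ n, ¬ LettersInv (letter n) (letter (n + 1))

/-- The prefix `X_n` of length `n` of an infinite reduced word `X`. -/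
def InfWord.prefixN {ι : Type*} (X : InfWord ι) (n : ℕ) : FreeGroup ι :=
  FreeGroup.mk (List.ofFn fun i : Fin n => X.letter i)

/-- The infinite word `X_k⁻¹ X` obtained by deleting the first `k` letters. -/
def InfWord.shift {ι : Type*} (X : InfWord ι) (k : ℕ) : InfWord ι :=
  ⟨fun n => X.letter (k + n), fun n => X.reduced (k + n)⟩

/-- A sequence `wₙ ∈ F(𝒜)` converges in `F(𝒜) ∪ ∂F(𝒜)` to the infinite word `X` iff
the length of the maximal common prefix of `wₙ` and `X` tends to infinity. -/
def TendstoBoundary {ι : Type*} [DecidableEq ι] (w : ℕ → FreeGroup ι) (X : InfWord ι) : Prop :=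
  ∀ k : ℕ, ∀ᶠ n in atTop, (w n).toWord.take k = List.ofFn fun i : Fin k => X.letter i

/-- `Y = w · X` for the left action of `F(𝒜)` on its boundary `∂F(𝒜)`. -/
def SmulBoundary {ι : Type*} [DecidableEq ι] (w : FreeGroup ι) (X Y : InfWord ι) : Prop :=
  TendstoBoundary (fun n => w * X.prefixN n) Y

/-- The (Cantor set) topology on `∂F(𝒜)`, induced by the product topology on sequences
of letters. -/
instance {ι : Type*} : TopologicalSpace (InfWord ι) :=
  TopologicalSpace.induced (fun X => X.letter)
    (@Pi.topologicalSpace ℕ (fun _ => ι × Bool) fun _ => ⊥)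

/-- A non-trivial element of `F(𝒜)` is cyclically reduced if the first letter of its reduced
word is not the inverse of its last letter. -/
def IsCyclicallyReduced {ι : Type*} [DecidableEq ι] (w : FreeGroup ι) : Prop :=
  w ≠ 1 ∧ ∀ a ∈ w.toWord.head?, ∀ b ∈ w.toWord.getLast?, ¬ LettersInv a b

/-- The dual laminary language `ℒ_𝒜(T)` of an isometric action of `F(𝒜)` on `T`. -/
def dualLanguage (ι : Type*) [DecidableEq ι] (T : Type*) [MetricSpace T]
    [MulAction (FreeGroup ι) T] : Set (FreeGroup ι) :=
  {v | ∀ ε > (0 : ℝ), ∃ u w : FreeGroup ι,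
      (u * v * w).toWord = u.toWord ++ v.toWord ++ w.toWord ∧
      IsCyclicallyReduced (u * v * w) ∧
      translationLength (FreeGroup ι) T (u * v * w) < ε}

/-- The dual laminary language `ℒ_𝒜(T)`, for the action restricted to an invariant
subtree `A`. -/
def dualLanguageOn (ι : Type*) [DecidableEq ι] {T : Type*} [MetricSpace T]
    [MulAction (FreeGroup ι) T] (A : Set T) : Set (FreeGroup ι) :=
  {v | ∀ ε > (0 : ℝ), ∃ u w : FreeGroup ι,
      (u * v * w).toWord = u.toWord ++ v.toWord ++ w.toWord ∧
      IsCyclicallyReduced (u * v * w) ∧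
      translationLengthOn A (u * v * w) < ε}

/-! ### Systems of isometries on a compact ℝ-tree -/

/-- A system of isometries `𝒦 = (K, 𝒜)`: a family, indexed by `ι`, of non-empty partial
isometries of the compact ℝ-tree `K`, i.e. isometries between non-empty closed subtrees. -/
structure SystemOfIsometries (K : Type*) [MetricSpace K] (ι : Type*) where
  pe : ι → PartialEquiv K K
  isom : ∀ i, ∀ x ∈ (pe i).source, ∀ y ∈ (pe i).source, dist (pe i x) (pe i y) = dist x y
  source_subtree : ∀ i, IsClosedSubtree (pe i).source
  target_subtree : ∀ i, IsClosedSubtree (pe i).target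

namespace SystemOfIsometries

variable {K : Type*} [MetricSpace K] {ι : Type*} (S : SystemOfIsometries K ι)

/-- The partial isometry associated to a letter in `𝒜^{±1}`. -/
def letterPE : ι × Bool → PartialEquiv K K
  | (i, true) => S.pe i
  | (i, false) => (S.pe i).symm

/-- The partial isometry `z₁ ∘ z₂ ∘ ⋯ ∘ zₙ` (acting on the right: first `z₁`, then `z₂`, …)
associated to the reduced word `w = z₁ ⋯ zₙ ∈ F(𝒜)`. -/
def wordPE [DecidableEq ι] (w : FreeGroup ι) : PartialEquiv K K :=
  (w.toWord.map S.letterPE).foldl PartialEquiv.trans (PartialEquiv.refl K)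

/-- The domain `dom (w)` of the partial isometry associated to `w`. -/
def dom [DecidableEq ι] (w : FreeGroup ι) : Set K := (S.wordPE w).source

/-- A word is admissible if it is non-empty as a partial isometry of `K`. -/
def Admissible [DecidableEq ι] (w : FreeGroup ι) : Prop := (S.dom w).Nonempty

/-- An infinite word is admissible if all its prefixes are admissible. -/
def AdmissibleInf [DecidableEq ι] (X : InfWord ι) : Prop := ∀ n, S.Admissible (X.prefixN n)

/-- The domain of an infinite word: the intersection of the domains of its prefixes. -/
def domInf [DecidableEq ι] (X : InfWord ι) : Set K := ⋂ n, S.dom (X.prefixN n)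

/-- An infinite word `X` is eventually admissible if some suffix `X_k⁻¹ X` is admissible. -/
def EventuallyAdmissible [DecidableEq ι] (X : InfWord ι) : Prop :=
  ∃ k, S.AdmissibleInf (X.shift k)

/-- The system `𝒦` has independent generators if the (non-empty) domain of every
admissible infinite word consists of exactly one point. -/
def IndependentGenerators [DecidableEq ι] : Prop :=
  ∀ X : InfWord ι, S.AdmissibleInf X → ∃ x : K, S.domInf X = {x}

/-- The admissible laminary language `ℒ_adm(𝒦)`: the largest laminary language consisting of
admissible words; `w ∈ ℒ_adm(𝒦)` iff for every `k` the word `w` is obtained from some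
admissible word `v` by deleting its prefix and its suffix of length `k`. -/
def admLanguage [DecidableEq ι] : Set (FreeGroup ι) :=
  {w | ∀ k : ℕ, ∃ v : FreeGroup ι, S.Admissible v ∧
      ∃ p s : List (ι × Bool), p.length = k ∧ s.length = k ∧
        v.toWord = p ++ w.toWord ++ s}

end SystemOfIsometries

/-- The ℝ-tree `T_𝒦` associated to a system of isometries `𝒦 = (K, 𝒜)`, presented through
its characteristic properties (Theorem 3.2 of the paper, by which it is unique):
`T_𝒦` contains `K` as an isometrically embedded subtree (1); the left action of `F(𝒜)`
is compatible with the partial isometries (2); every orbit meets `K`, and indeed every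
segment is covered by finitely many translates of `K` (3); and `T_𝒦` is universal among
trees satisfying (1) and (2), via unique equivariant morphisms (4). -/
structure AssocTree {K : Type} [MetricSpace K] {ι : Type} [DecidableEq ι]
    (S : SystemOfIsometries K ι) where
  carrier : Type
  [ms : MetricSpace carrier]
  tree : IsRTree carrier
  [act : MulAction (FreeGroup ι) carrier]
  act_isom : ∀ g : FreeGroup ι, Isometry fun x : carrier => g • x
  emb : K → carrier
  emb_isom : Isometry emb
  emb_subtree : IsSubtree (Set.range emb)
  compat : ∀ i : ι, ∀ x ∈ (S.pe i).source, (FreeGroup.of i)⁻¹ • emb x = emb (S.pe i x)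
  orbit_meets : ∀ p : carrier, ∃ (w : FreeGroup ι) (x : K), p = w • emb x
  seg_cover : ∀ p q : carrier, ∃ F : Finset (FreeGroup ι),
      seg p q ⊆ ⋃ w ∈ F, w • Set.range emb
  universal : ∀ (T' : Type) [MetricSpace T'] [MulAction (FreeGroup ι) T'],
      (∀ g : FreeGroup ι, Isometry fun x : T' => g • x) →
      ∀ e' : K → T', Isometry e' →
      (∀ i : ι, ∀ x ∈ (S.pe i).source, (FreeGroup.of i)⁻¹ • e' x = e' (S.pe i x)) →
      ∃! f : carrier → T', IsTreeMorphism f ∧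
        (∀ (g : FreeGroup ι) (p : carrier), f (g • p) = g • f p) ∧
        ∀ x : K, f (emb x) = e' x

attribute [instance] AssocTree.ms AssocTree.act

/-! ### Very small minimal actions with dense orbits, and their metric completion -/

/-- An ℝ-tree `T` (here: the subtree `Tsub` of the complete ℝ-tree `Tb`, whose metric
completion `T̄` is `Tb`) with a very small, minimal, isometric action of the free group
`F(𝒜)` with dense orbits.  (For actions with dense orbits, "very small" is equivalent to
"trivial arc stabilizers".) -/
structure TreeSetup (ι : Type) where
  Tb : Type
  [ms : MetricSpace Tb]
  complete : CompleteSpace Tb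
  tree : IsRTree Tb
  [act : MulAction (FreeGroup ι) Tb]
  act_isom : ∀ g : FreeGroup ι, Isometry fun x : Tb => g • x
  Tsub : Set Tb
  nonempty : Tsub.Nonempty
  dense : Dense Tsub
  sub_subtree : IsSubtree Tsub
  invariant : ∀ g : FreeGroup ι, ∀ x ∈ Tsub, g • x ∈ Tsub
  minimal : ∀ A : Set Tb, A ⊆ Tsub → A.Nonempty → IsSubtree A →
      (∀ g : FreeGroup ι, ∀ x ∈ A, g • x ∈ A) → A = Tsub
  dense_orbits : ∀ x ∈ Tsub, Tsub ⊆ closure (Set.range fun g : FreeGroup ι => g • x)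
  arc_stab : ∀ g : FreeGroup ι, ∀ x ∈ Tsub, ∀ y ∈ Tsub, x ≠ y →
      (fun p => g • p) '' seg x y = seg x y → g = 1

attribute [instance] TreeSetup.ms TreeSetup.act

/-- `𝒬(X) = Q` (for `Q ∈ T̄`), where `𝒬 : ∂F_N → T̂` is the map of Levitt–Lustig:
it is characterized by the property that whenever a sequence `uₙ ∈ F_N` converges to
`X ∈ ∂F_N` and `uₙ P` converges metrically in `T̄` to a point `Q`, then `𝒬(X) = Q`. -/
def QRel {ι : Type} [DecidableEq ι] (St : TreeSetup ι) (X : InfWord ι) (Q : St.Tb) : Prop :=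
  ∃ P ∈ St.Tsub, ∃ u : ℕ → FreeGroup ι, TendstoBoundary u X ∧
    Tendsto (fun n => u n • P) atTop (𝓝 Q)

/-- The limit set `Ω_𝒜 = 𝒬²(C²_𝒜 ∩ L²(T)) ⊆ T̄`: images of pairs of distinct boundary
points with distinct first letters (w.r.t. the basis `𝒜`) that are identified by `𝒬`. -/
def limitSet {ι : Type} [DecidableEq ι] (St : TreeSetup ι) : Set St.Tb :=
  {Q | ∃ X Y : InfWord ι, X.letter 0 ≠ Y.letter 0 ∧ QRel St X Q ∧ QRel St Y Q}

/-- The heart `K_𝒜 ⊆ T̄`: the convex hull of the limit set `Ω_𝒜`. -/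
def heart {ι : Type} [DecidableEq ι] (St : TreeSetup ι) : Set St.Tb :=
  subtreeHull (limitSet St)

/-- The dual algebraic lamination `L²(T) = {(X,Y) ∈ ∂²F_N : 𝒬(X) = 𝒬(Y)}`. -/
def L2 {ι : Type} [DecidableEq ι] (St : TreeSetup ι) : Set (InfWord ι × InfWord ι) :=
  {p | p.1 ≠ p.2 ∧ ∃ Q : St.Tb, QRel St p.1 Q ∧ QRel St p.2 Q}

/-! ### The system of isometries induced on a compact subtree `K ⊆ T̄` -/

/-- The domain, inside `T̄`, of the partial isometry `x ↦ w⁻¹ x` of `K` induced by the word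
`w`: the intersection of the translates of `K` by the prefixes of `w`. -/
def inducedDom {ι : Type} [DecidableEq ι] (St : TreeSetup ι) (K : Set St.Tb)
    (w : FreeGroup ι) : Set St.Tb :=
  ⋂ n ∈ Finset.range (w.toWord.length + 1), gprefix w n • K

/-- Admissibility of a word for the induced system of isometries `𝒦 = (K, 𝒜)`. -/
def InducedAdmissible {ι : Type} [DecidableEq ι] (St : TreeSetup ι) (K : Set St.Tb)
    (w : FreeGroup ι) : Prop :=
  (inducedDom St K w).Nonempty

/-- The admissible laminary language `ℒ_adm(𝒦)` of the induced system `𝒦 = (K, 𝒜)`. -/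
def inducedAdmLanguage {ι : Type} [DecidableEq ι] (St : TreeSetup ι) (K : Set St.Tb) :
    Set (FreeGroup ι) :=
  {w | ∀ k : ℕ, ∃ v : FreeGroup ι, InducedAdmissible St K v ∧
      ∃ p s : List (ι × Bool), p.length = k ∧ s.length = k ∧
        v.toWord = p ++ w.toWord ++ s}

/-- Admissibility of an infinite word for the induced system `𝒦 = (K, 𝒜)`. -/
def InducedAdmissibleInf {ι : Type} [DecidableEq ι] (St : TreeSetup ι) (K : Set St.Tb)
    (X : InfWord ι) : Prop :=
  ∀ n, InducedAdmissible St K (X.prefixN n)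

/-- The domain `dom(X) = ⋂ₙ dom(Xₙ)` of an infinite word, for the induced system. -/
def inducedDomInf {ι : Type} [DecidableEq ι] (St : TreeSetup ι) (K : Set St.Tb)
    (X : InfWord ι) : Set St.Tb :=
  ⋂ n, X.prefixN n • K

/-- Compatibility of a map `e : K → T'` with the system of partial isometries induced on
`K ⊆ T̄` by the basis `𝒜`: this is condition (2) of Theorem 3.2 for the induced system. -/
def InducedCompat {ι : Type} (St : TreeSetup ι) (K : Set St.Tb) {T' : Type} [MetricSpace T']
    [MulAction (FreeGroup ι) T'] (e : K → T') : Prop :=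
  ∀ (i : ι) (x : K) (h : (FreeGroup.of i)⁻¹ • (x : St.Tb) ∈ K),
    (FreeGroup.of i)⁻¹ • e x = e ⟨(FreeGroup.of i)⁻¹ • (x : St.Tb), h⟩

/-- The tree `T_𝒦` associated to the system of isometries induced on a compact subtree
`K ⊆ T̄`, presented through the characteristic properties of Theorem 3.2 (by which it is
unique), together with the canonical `F(𝒜)`-equivariant morphism `j : T_𝒦 → T̄` restricting
to the identity on `K`. -/
structure InducedAssoc {ι : Type} (St : TreeSetup ι) (K : Set St.Tb) where
  TK : Type
  [ms : MetricSpace TK]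
  tree : IsRTree TK
  [act : MulAction (FreeGroup ι) TK]
  act_isom : ∀ g : FreeGroup ι, Isometry fun x : TK => g • x
  emb : K → TK
  emb_isom : Isometry emb
  emb_subtree : IsSubtree (Set.range emb)
  compat : InducedCompat St K emb
  orbit_meets : ∀ p : TK, ∃ (w : FreeGroup ι) (x : K), p = w • emb x
  seg_cover : ∀ p q : TK, ∃ F : Finset (FreeGroup ι),
      seg p q ⊆ ⋃ w ∈ F, w • Set.range emb
  universal : ∀ (T' : Type) [MetricSpace T'] [MulAction (FreeGroup ι) T'],
      (∀ g : FreeGroup ι, Isometry fun x : T' => g • x) →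
      ∀ e' : K → T', Isometry e' → InducedCompat St K e' →
      ∃! f : TK → T', IsTreeMorphism f ∧
        (∀ (g : FreeGroup ι) (p : TK), f (g • p) = g • f p) ∧
        ∀ x : K, f (emb x) = e' x
  jmap : TK → St.Tb
  jmap_morphism : IsTreeMorphism jmap
  jmap_equivariant : ∀ (g : FreeGroup ι) (p : TK), jmap (g • p) = g • jmap p
  jmap_emb : ∀ x : K, jmap (emb x) = (x : St.Tb)

attribute [instance] InducedAssoc.ms InducedAssoc.act

/-! ### Change of basis -/

/-- Changing the basis of the free group: the same tree, with the action precomposed with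
the automorphism `φ` of `F(𝒜)`.  The heart of `St.twist φ` is the heart of `T` with respect
to the basis `φ(𝒜)`. -/
def TreeSetup.twist {ι : Type} (St : TreeSetup ι) (φ : FreeGroup ι ≃* FreeGroup ι) :
    TreeSetup ι where
  Tb := St.Tb
  ms := St.ms
  complete := St.complete
  tree := St.tree
  act := { smul := fun g x => φ g • x
           one_smul := fun x => by show φ 1 • x = x; rw [map_one, one_smul]
           mul_smul := fun g h x => by
             show φ (g * h) • x = φ g • φ h • x
             rw [map_mul, mul_smul] }
  act_isom := fun g => St.act_isom (φ g)
  Tsub := St.Tsub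
  nonempty := St.nonempty
  dense := St.dense
  sub_subtree := St.sub_subtree
  invariant := fun g x hx => St.invariant (φ g) x hx
  minimal := fun A hA hne hsub hinv => St.minimal A hA hne hsub (fun g x hx => by
    have h : φ (φ.symm g) • x ∈ A := hinv (φ.symm g) x hx
    rwa [MulEquiv.apply_symm_apply] at h)
  dense_orbits := fun x hx => by
    have hr : (Set.range fun g : FreeGroup ι => φ g • x) =
        Set.range fun g : FreeGroup ι => g • x := by
      apply Set.ext; intro y
      constructor
      · rintro ⟨g, rfl⟩; exact ⟨φ g, rfl⟩
      · rintro ⟨g, rfl⟩; exact ⟨φ.symm g, by simp⟩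
    show St.Tsub ⊆ closure (Set.range fun g : FreeGroup ι => φ g • x)
    rw [hr]; exact St.dense_orbits x hx
  arc_stab := fun g x hx y hy hxy him => by
    have h1 : φ g = 1 := St.arc_stab (φ g) x hx y hy hxy him
    have h2 := congrArg φ.symm h1
    simpa using h2

/-! ### The boundary `∂T`, the space `T̂ = T̄ ∪ ∂T` and the observers' topology -/

/-- An isometric ray (parametrized on `[0,∞)`) in a metric space. -/
def IsRay {T : Type} [MetricSpace T] (r : ℝ → T) : Prop :=
  ∀ s t : ℝ, 0 ≤ s → 0 ≤ t → dist (r s) (r t) = |s - t|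

/-- The type of isometric rays in `T`. -/
def Ray (T : Type) [MetricSpace T] : Type := {r : ℝ → T // IsRay r}

/-- Two rays define the same end iff they are at bounded distance. -/
def rayEnd (T : Type) [MetricSpace T] : Setoid (Ray T) where
  r := fun r₁ r₂ => ∃ C : ℝ, ∀ t : ℝ, 0 ≤ t → dist (r₁.1 t) (r₂.1 t) ≤ C
  iseqv := by
    refine ⟨fun r => ⟨0, fun t _ => by simp⟩, ?_, ?_⟩
    · rintro r₁ r₂ ⟨C, hC⟩
      exact ⟨C, fun t ht => by rw [dist_comm]; exact hC t ht⟩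
    · rintro r₁ r₂ r₃ ⟨C, hC⟩ ⟨D, hD⟩
      exact ⟨C + D, fun t ht =>
        (dist_triangle _ (r₂.1 t) _).trans (add_le_add (hC t ht) (hD t ht))⟩

/-- The Gromov boundary `∂T`: ends of `T`, i.e. classes of rays at bounded distance. -/
def GromovBoundary (T : Type) [MetricSpace T] : Type := Quotient (rayEnd T)

/-- The space `T̂ = T̄ ∪ ∂T` (for `T` a complete ℝ-tree, representing the completion `T̄`). -/
def TreeHat (T : Type) [MetricSpace T] : Type := T ⊕ GromovBoundary T

/-- The segment `[x, ξ]` from a point `x ∈ T̄` to a boundary point `ξ ∈ ∂T`. -/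
def raySeg {T : Type} [MetricSpace T] (x : T) (ξ : GromovBoundary T) : Set (TreeHat T) :=
  ({Sum.inr ξ} : Set (TreeHat T)) ∪ Sum.inl ''
    {p | ∃ r : Ray T, Quotient.mk (rayEnd T) r = ξ ∧ r.1 0 = x ∧ ∃ t : ℝ, 0 ≤ t ∧ r.1 t = p}

/-- The segment `[ξ, η]` between two boundary points. -/
def lineSeg {T : Type} [MetricSpace T] (ξ η : GromovBoundary T) : Set (TreeHat T) :=
  ({Sum.inr ξ, Sum.inr η} : Set (TreeHat T)) ∪ Sum.inl ''
    {p | ∃ r r' : Ray T, Quotient.mk (rayEnd T) r = ξ ∧ Quotient.mk (rayEnd T) r' = η ∧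
      r.1 0 = p ∧ r'.1 0 = p ∧ ∀ s t : ℝ, 0 ≤ s → 0 ≤ t → dist (r.1 s) (r'.1 t) = s + t}

/-- The segment `[P, Q]` between two points of `T̂ = T̄ ∪ ∂T`. -/
def segHat {T : Type} [MetricSpace T] : TreeHat T → TreeHat T → Set (TreeHat T)
  | Sum.inl x, Sum.inl y => Sum.inl '' seg x y
  | Sum.inl x, Sum.inr ξ => raySeg x ξ
  | Sum.inr ξ, Sum.inl x => raySeg x ξ
  | Sum.inr ξ, Sum.inr η => lineSeg ξ η

/-- The observers' topology on `T̂`: generated by the set of directions, where the direction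
at `P` containing `x` is the set of points `y` with `P ∉ [x,y]` (i.e. the connected component
of `T̂ ∖ {P}` containing `x`). -/
def observersTopology (T : Type) [MetricSpace T] : TopologicalSpace (TreeHat T) :=
  TopologicalSpace.generateFrom
    {D | ∃ P x : TreeHat T, x ≠ P ∧ D = {y | y ≠ P ∧ P ∉ segHat x y}}

/-- The extension to `T̂ = T̄ ∪ ∂T` of an isometric action on `T̄`. -/
def TreeHat.smul {T : Type} [MetricSpace T] {G : Type} [Group G] [MulAction G T]
    (hiso : ∀ g : G, Isometry fun x : T => g • x) (g : G) : TreeHat T → TreeHat T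
  | Sum.inl x => Sum.inl (g • x)
  | Sum.inr ξ => Sum.inr <| Quotient.map'
      (fun r : Ray T => (⟨fun t => g • r.1 t, fun s t hs ht => by
        have h := (hiso g).dist_eq (r.1 s) (r.1 t)
        simpa using h.trans (r.2 s t hs ht)⟩ : Ray T))
      (fun r r' h => by
        obtain ⟨C, hC⟩ := h
        exact ⟨C, fun t ht => by
          have h' := (hiso g).dist_eq (r.1 t) (r'.1 t)
          simpa using h'.le.trans (hC t ht)⟩) ξ

/-! ### Laminations -/

/-- An algebraic lamination (as a set of pairs of boundary points) is closed by diagonal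
leaves. -/
def ClosedByDiagonal {ι : Type} (L : Set (InfWord ι × InfWord ι)) : Prop :=
  ∀ X X' X'' : InfWord ι, (X, X') ∈ L → (X', X'') ∈ L → X = X'' ∨ (X, X'') ∈ L

/-- Invariance of a lamination under the `F(𝒜)`-action on `∂²F(𝒜)`. -/
def InvariantLam {ι : Type} [DecidableEq ι] (L : Set (InfWord ι × InfWord ι)) : Prop :=
  ∀ (w : FreeGroup ι) (X X' Y Y' : InfWord ι), (X, X') ∈ L →
    SmulBoundary w X Y → SmulBoundary w X' Y' → (Y, Y') ∈ L

/-- Invariance of a lamination under the flip map. -/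
def FlipInvariant {ι : Type} (L : Set (InfWord ι × InfWord ι)) : Prop :=
  ∀ X Y : InfWord ι, (X, Y) ∈ L → (Y, X) ∈ L

/-- The dual lamination `L²(T)` is minimal up to diagonal leaves: it contains no proper
non-trivial sublamination that is closed by diagonal leaves. -/
def MinimalUpToDiagonal {ι : Type} [DecidableEq ι] (St : TreeSetup ι) : Prop :=
  ∀ L : Set (InfWord ι × InfWord ι), L ⊆ L2 St → L.Nonempty → IsClosed L →
    InvariantLam L → FlipInvariant L → ClosedByDiagonal L → L = L2 St

end CHL

namespace CHL

/-! ### Betweenness in `0`-hyperbolic spaces -/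

section Betweenness

variable {X : Type*} [MetricSpace X]

lemma left_mem_seg (x y : X) : x ∈ seg x y := by simp [seg]

lemma mem_seg_comm {x y z : X} (h : z ∈ seg x y) : z ∈ seg y x := by
  simp only [seg, mem_ofPred_eq] at *
  rw [dist_comm y z, dist_comm z x, dist_comm y x]; linarith

/-- Points of `[x,c]` lie on `[x,y]` when `c` does. -/
lemma mem_seg_trans {x y c z : X} (hz : z ∈ seg x c) (hc : c ∈ seg x y) : z ∈ seg x y := by
  simp only [seg, mem_ofPred_eq] at *
  have := dist_triangle z c y
  have := dist_triangle x z y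
  linarith

/-- A point of `[x,y]` lies on `[x,z]` or on `[z,y]`. -/
lemma mem_seg_or [IsRTree X] {x y p : X} (h : p ∈ seg x y) (z : X) :
    p ∈ seg x z ∨ p ∈ seg z y := by
  have h4 := IsRTree.four_point x y z p
  simp only [seg, mem_ofPred_eq] at *
  have := dist_triangle x p z
  have := dist_triangle z p y
  have := dist_comm p y
  have := dist_comm p z
  have := dist_comm y z
  rcases le_max_iff.1 h4 with h4 | h4
  · left; linarith
  · right; linarith

/-- Two points of a segment at equal distance from its origin coincide. -/
lemma eq_of_mem_seg [IsRTree X] {x y p q : X} (hp : p ∈ seg x y) (hq : q ∈ seg x y)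
    (h : dist x p = dist x q) : p = q := by
  have h4 := IsRTree.four_point x y p q
  simp only [seg, mem_ofPred_eq] at *
  have := dist_comm y q
  have := dist_comm y p
  rw [← dist_le_zero]
  rcases le_max_iff.1 h4 with h4 | h4 <;> linarith

lemma isSubtree_subtreeHull (S : Set X) : IsSubtree (subtreeHull S) := fun x hx y hy _ hz A hA =>
  hA.2 x (hx A hA) y (hy A hA) hz

lemma subset_subtreeHull (S : Set X) : S ⊆ subtreeHull S := fun _ hx _ hA => hA.1 hx

/-- In an `ℝ`-tree, the convex hull is the union of the segments joining pairs of points. -/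
lemma exists_mem_seg_of_mem_subtreeHull [IsRTree X] {S : Set X} {p : X}
    (hp : p ∈ subtreeHull S) : ∃ a ∈ S, ∃ b ∈ S, p ∈ seg a b := by
  refine hp {p | ∃ a ∈ S, ∃ b ∈ S, p ∈ seg a b} ⟨fun a ha => ⟨a, ha, a, ha, left_mem_seg a a⟩, ?_⟩
  rintro x ⟨a, ha, b, hb, hx⟩ y ⟨c, hc, d, hd, hy⟩ z hz
  rcases mem_seg_or hz c with h | h
  · rcases mem_seg_or h a with h' | h'
    · exact ⟨a, ha, b, hb, mem_seg_trans (mem_seg_comm h') hx⟩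
    · exact ⟨a, ha, c, hc, h'⟩
  · exact ⟨c, hc, d, hd, mem_seg_trans h hy⟩

/-- If `S` meets every segment joining one of `a, a'` to one of `b, b'`, then the
intersection of `[a,a']` and `[b,b']` is contained in the convex hull of `S`. -/
lemma mem_subtreeHull_of_separates [IsRTree X] {S : Set X} {p a a' b b' : X}
    (ha : p ∈ seg a a') (hb : p ∈ seg b b')
    (hS : ∀ x ∈ ({a, a'} : Set X), ∀ y ∈ ({b, b'} : Set X), ∃ r ∈ S, r ∈ seg x y) :
    p ∈ subtreeHull S := by
  obtain ⟨r₀, hr₀, -⟩ := hS a (by simp) b (by simp)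
  obtain ⟨x, hx, hxp⟩ : ∃ x ∈ ({a, a'} : Set X), p ∈ seg x r₀ := by
    rcases mem_seg_or ha r₀ with h | h
    exacts [⟨a, by simp, h⟩, ⟨a', by simp, mem_seg_comm h⟩]
  obtain ⟨y, hy, hyp⟩ : ∃ y ∈ ({b, b'} : Set X), p ∈ seg y r₀ := by
    rcases mem_seg_or hb r₀ with h | h
    exacts [⟨b, by simp, h⟩, ⟨b', by simp, mem_seg_comm h⟩]
  obtain ⟨r, hr, hrxy⟩ := hS x hx y hy
  have hull := isSubtree_subtreeHull S r (subset_subtreeHull S hr) r₀ (subset_subtreeHull S hr₀)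
  rcases mem_seg_or hxp r with h | h
  · rcases mem_seg_or hyp r with h' | h'
    · have hpr : p = r := by
        simp only [seg, mem_ofPred_eq] at h h' hrxy
        have := dist_triangle x p y
        have := dist_comm r y
        have := dist_comm p y
        rw [← dist_le_zero]; linarith
      exact hpr ▸ subset_subtreeHull S hr
    · exact hull h'
  · exact hull h

/-- Two closed sets that cover an `ℝ`-tree and contain one endpoint of a segment each have a
common point on that segment. -/
lemma exists_mem_seg_of_isClosed_cover [IsRTree X] {A B : Set X} (hA : IsClosed A)
    (hB : IsClosed B) (hAB : A ∪ B = univ) {a b : X} (ha : a ∈ A) (hb : b ∈ B) :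
    ∃ r ∈ seg a b, r ∈ A ∩ B := by
  obtain ⟨f, hf0, hf1, hf⟩ := IsRTree.geodesic a b
  have hd : (0 : ℝ) ≤ dist a b := dist_nonneg
  have h0 : (0 : ℝ) ∈ Icc 0 (dist a b) := ⟨le_rfl, hd⟩
  have h1 : dist a b ∈ Icc 0 (dist a b) := ⟨hd, le_rfl⟩
  have hcont : ContinuousOn f (Icc 0 (dist a b)) := by
    have : LipschitzOnWith 1 f (Icc 0 (dist a b)) :=
      LipschitzOnWith.of_dist_le_mul fun s hs t ht => by
        rw [hf s hs t ht, Real.dist_eq]; simp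
    exact this.continuousOn
  have hpre := isPreconnected_Icc.image f hcont
  obtain ⟨r, ⟨t, ht, rfl⟩, hr⟩ := isPreconnected_closed_iff.1 hpre A B hA hB
    (by rw [hAB]; exact subset_univ _) ⟨a, ⟨0, h0, hf0⟩, ha⟩ ⟨b, ⟨_, h1, hf1⟩, hb⟩
  refine ⟨f t, ?_, hr⟩
  have e0 := hf 0 h0 t ht
  have e1 := hf t ht _ h1
  rw [hf0] at e0
  rw [hf1] at e1
  rw [seg, mem_ofPred_eq, e0, e1, abs_of_nonpos (by linarith [ht.1]),
    abs_of_nonpos (by linarith [ht.2])]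
  ring

/-- The segments `[b,a]` and `[b,c]` agree up to distance the Gromov product of `a` and `c`
at `b`. -/
lemma eq_of_dist_gromov [IsRTree X] {a b c a' c' : X} {δ : ℝ}
    (h : dist a b + dist b c - 2 * δ = dist a c) (ha : a' ∈ seg b a) (hc : c' ∈ seg b c)
    (hab : dist b a' = δ) (hcb : dist b c' = δ) : a' = c' := by
  simp only [seg, mem_ofPred_eq] at ha hc
  have h1 := IsRTree.four_point c' a b c
  have h2 := IsRTree.four_point a' c' b a
  have := dist_comm a b
  have := dist_comm a' b
  have := dist_comm c' b
  have := dist_comm a' a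
  have := dist_comm c' a
  have := dist_comm c' c
  have := dist_comm a' c'
  rw [← dist_le_zero]
  have h3 : dist c' a ≤ dist a b - δ := by
    rcases le_max_iff.1 h1 with h1 | h1 <;> linarith
  rcases le_max_iff.1 h2 with h2 | h2 <;> linarith

/-- A continuous injective path into an `ℝ`-tree that is isometric immediately to the right
of every point is isometric. -/
lemma dist_eq_of_locally_isometric [IsRTree X] {g : ℝ → X} (hg : Continuous g) {L : ℝ}
    (hL : 0 ≤ L) (hinj : InjOn g (Icc 0 L))
    (hloc : ∀ x ∈ Ico 0 L, ∃ y > x, ∀ s ∈ Ioc x y, ∀ t ∈ Ioc x y, dist (g s) (g t) = |s - t|) :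
    dist (g 0) (g L) = L := by
  let S : Set ℝ := {t | ∀ r ∈ Icc 0 L, ∀ r' ∈ Icc 0 L,
    dist (g (min r t)) (g (min r' t)) = |min r t - min r' t|}
  have hS : IsClosed S := by
    have : S = ⋂ r ∈ Icc 0 L, ⋂ r' ∈ Icc 0 L,
        {t | dist (g (min r t)) (g (min r' t)) = |min r t - min r' t|} := by
      ext; simp only [S, mem_ofPred_eq, mem_iInter]
    rw [this]
    exact isClosed_biInter fun r _ => isClosed_biInter fun r' _ =>
      isClosed_eq (by fun_prop) (by fun_prop)
  have key : Icc 0 L ⊆ S := by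
    refine (hS.inter isClosed_Icc).Icc_subset_of_forall_exists_gt ?_ ?_
    · intro r hr r' hr'
      simp [hr.1, hr'.1]
    rintro x ⟨hxS, hx⟩ y hy
    obtain ⟨z, hz, hzloc⟩ := hloc x hx
    let m := min (min y z) L
    have hxm : x < m := lt_min (lt_min hy hz) hx.2
    have hmL : m ≤ L := min_le_right _ _
    have hmz : m ≤ z := (min_le_left _ _).trans (min_le_right _ _)
    have before : ∀ s ∈ Icc 0 x, ∀ t ∈ Icc 0 x, dist (g s) (g t) = |s - t| := by
      intro s hs t ht
      have := hxS s ⟨hs.1, hs.2.trans hx.2.le⟩ t ⟨ht.1, ht.2.trans hx.2.le⟩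
      rwa [min_eq_left hs.2, min_eq_left ht.2] at this
    have after : ∀ t ∈ Ioc x m, dist (g x) (g t) = t - x := by
      intro t ht
      have l1 : Tendsto (fun s => dist (g s) (g t)) (𝓝[>] x) (𝓝 (dist (g x) (g t))) :=
        ((by fun_prop : Continuous fun s => dist (g s) (g t)).tendsto x).mono_left
          nhdsWithin_le_nhds
      have l2 : Tendsto (fun s => |s - t|) (𝓝[>] x) (𝓝 |x - t|) :=
        ((by fun_prop : Continuous fun s => |s - t|).tendsto x).mono_left nhdsWithin_le_nhds
      have e : (fun s => dist (g s) (g t)) =ᶠ[𝓝[>] x] fun s => |s - t| := by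
        filter_upwards [Ioc_mem_nhdsGT hz] with s hs
        exact hzloc s hs t ⟨ht.1, ht.2.trans hmz⟩
      have := tendsto_nhds_unique (l1.congr' e) l2
      rw [this, abs_of_nonpos (by linarith [ht.1])]; ring
    have cross : ∀ s ∈ Icc 0 x, ∀ t ∈ Ioc x m, dist (g s) (g t) = t - s := by
      intro s hs t ht
      have e1 := before s hs x ⟨hx.1, le_rfl⟩
      rw [abs_of_nonpos (by linarith [hs.2])] at e1
      have e2 := after t ht
      by_contra hne
      have tri := dist_triangle (g s) (g x) (g t)
      have tri1 := dist_triangle (g x) (g s) (g t)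
      have tri2 := dist_triangle (g s) (g t) (g x)
      have c1 := dist_comm (g s) (g x)
      have c2 := dist_comm (g t) (g x)
      obtain ⟨δ, hδ⟩ : ∃ δ, δ = (t - s - dist (g s) (g t)) / 2 := ⟨_, rfl⟩
      have hδ0 : 0 < δ := by
        have : dist (g s) (g t) < t - s := lt_of_le_of_ne (by linarith) hne
        rw [hδ]; linarith
      have hδ1 : δ ≤ x - s := by rw [hδ]; linarith
      have hδ2 : δ ≤ t - x := by rw [hδ]; linarith
      have hs0 := hs.1
      have ht1 := ht.1
      have ht2 := ht.2
      have ml : x - δ ∈ Icc 0 x := ⟨by linarith, by linarith⟩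
      have mr : x + δ ∈ Ioc x m := ⟨by linarith, by linarith⟩
      have d1 := before x ⟨hx.1, le_rfl⟩ (x - δ) ml
      rw [abs_of_nonneg (by linarith)] at d1
      have d2 := after _ mr
      have d3 := before (x - δ) ml s hs
      rw [abs_of_nonneg (by linarith)] at d3
      have d4 := hzloc (x + δ) ⟨mr.1, mr.2.trans hmz⟩ t ⟨ht.1, ht.2.trans hmz⟩
      rw [abs_of_nonpos (by linarith)] at d4
      have fold : g (x - δ) = g (x + δ) := by
        refine eq_of_dist_gromov (a := g s) (b := g x) (c := g t) (δ := δ)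
          (by rw [hδ]; ring_nf; linarith)
          ?_ ?_ (by linarith) (by linarith)
        · rw [seg, mem_ofPred_eq]; linarith
        · rw [seg, mem_ofPred_eq]; linarith
      have := hinj ⟨ml.1, by linarith⟩ ⟨by linarith, by linarith⟩ fold
      linarith
    have main : ∀ s ∈ Icc 0 m, ∀ t ∈ Icc 0 m, s ≤ t → dist (g s) (g t) = t - s := by
      intro s hs t ht hst
      rcases le_or_gt t x with htx | htx
      · rw [before s ⟨hs.1, hst.trans htx⟩ t ⟨ht.1, htx⟩, abs_of_nonpos (by linarith)]; ring
      · rcases le_or_gt s x with hsx | hsx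
        · exact cross s ⟨hs.1, hsx⟩ t ⟨htx, ht.2⟩
        · rw [hzloc s ⟨hsx, hs.2.trans hmz⟩ t ⟨htx, ht.2.trans hmz⟩,
            abs_of_nonpos (by linarith)]
          ring
    refine ⟨m, fun r hr r' hr' => ?_, hxm, (min_le_left _ _).trans (min_le_left _ _)⟩
    have hm0 : 0 ≤ m := hx.1.trans hxm.le
    have b1 : min r m ∈ Icc 0 m := ⟨le_min hr.1 hm0, min_le_right _ _⟩
    have b2 : min r' m ∈ Icc 0 m := ⟨le_min hr'.1 hm0, min_le_right _ _⟩
    rcases le_total (min r m) (min r' m) with h | h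
    · rw [main _ b1 _ b2 h, abs_of_nonpos (by linarith)]; ring
    · rw [dist_comm, main _ b2 _ b1 h, abs_of_nonneg (by linarith)]
  have := key ⟨hL, le_rfl⟩ 0 ⟨le_rfl, hL⟩ L ⟨hL, le_rfl⟩
  simpa [hL, abs_of_nonneg] using this

end Betweenness

/-! ### First letters of reduced words -/

section FirstLetter

variable {ι : Type*}

/-- The inverse of a letter of `𝒜^{±1}`. -/
def letterInv (z : ι × Bool) : ι × Bool := (z.1, !z.2)

lemma inv_mk_singleton (z : ι × Bool) :
    (FreeGroup.mk [z])⁻¹ = FreeGroup.mk [letterInv z] := by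
  simp [FreeGroup.inv_mk, FreeGroup.invRev, letterInv]

variable [DecidableEq ι]

lemma toWord_mk_mul {z : ι × Bool} {u : FreeGroup ι}
    (h : ∀ y ∈ u.toWord.head?, y ≠ letterInv z) :
    (FreeGroup.mk [z] * u).toWord = z :: u.toWord := by
  have hu : FreeGroup.IsReduced u.toWord := FreeGroup.isReduced_toWord
  have hr : FreeGroup.IsReduced (z :: u.toWord) := by
    rcases hw : u.toWord with _ | ⟨y, l⟩
    · exact FreeGroup.IsReduced.singleton
    · rw [hw] at hu h
      refine FreeGroup.isReduced_cons_cons.2 ⟨fun h1 => ?_, hu⟩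
      by_contra h2
      refine h y (by simp) (Prod.ext h1.symm ?_)
      revert h2
      simp only [letterInv]
      cases z.2 <;> cases y.2 <;> simp
  have e : FreeGroup.mk [z] * u = FreeGroup.mk (z :: u.toWord) := by
    conv_lhs => rw [← FreeGroup.mk_toWord (x := u)]
    rw [FreeGroup.mul_mk]; rfl
  rw [e, FreeGroup.toWord_mk, hr.reduce_eq]

lemma head?_mul_mk_singleton {u : FreeGroup ι} (a : ι × Bool) (h : 1 < u.toWord.length) :
    (u * FreeGroup.mk [a]).toWord.head? = u.toWord.head? := by
  have hu : FreeGroup.IsReduced u.toWord := FreeGroup.isReduced_toWord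
  rcases List.eq_nil_or_concat' u.toWord with h0 | ⟨l, b, hl⟩
  · simp [h0] at h
  have hlne : l ≠ [] := by rintro rfl; simp [hl] at h
  have e : u * FreeGroup.mk [a] = FreeGroup.mk (l ++ [b] ++ [a]) := by
    conv_lhs => rw [← FreeGroup.mk_toWord (x := u)]
    rw [FreeGroup.mul_mk, hl]
  by_cases hba : b = letterInv a
  · have e2 : u * FreeGroup.mk [a] = FreeGroup.mk l := by
      rw [e, List.append_assoc, ← FreeGroup.mul_mk, ← FreeGroup.mul_mk, hba,
        ← inv_mk_singleton, inv_mul_cancel, mul_one]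
    rw [e2, FreeGroup.toWord_mk, FreeGroup.IsReduced.reduce_eq (hu.infix ⟨[], [b], by simp [hl]⟩),
      hl, List.head?_append_of_ne_nil _ hlne]
  · have hr : FreeGroup.IsReduced (l ++ [b] ++ [a]) := by
      refine FreeGroup.IsReduced.append_overlap (hl ▸ hu) ?_ (by simp)
      refine FreeGroup.isReduced_cons_cons.2 ⟨fun h1 => ?_, FreeGroup.IsReduced.singleton⟩
      by_contra h2
      refine hba (Prod.ext h1 ?_)
      revert h2
      simp only [letterInv]
      cases a.2 <;> cases b.2 <;> simp
    rw [e, FreeGroup.toWord_mk, hr.reduce_eq, hl, List.append_assoc,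
      List.head?_append_of_ne_nil _ hlne, List.head?_append_of_ne_nil _ hlne]

lemma length_le_length_mul_add (u g : FreeGroup ι) :
    u.toWord.length ≤ (u * g).toWord.length + g.toWord.length := by
  have := FreeGroup.norm_mul_le (u * g) g⁻¹
  rwa [mul_inv_cancel_right, FreeGroup.norm_inv_eq] at this

lemma head?_mul_of_length_lt {u g : FreeGroup ι} (h : g.toWord.length < u.toWord.length) :
    (u * g).toWord.head? = u.toWord.head? := by
  suffices H : ∀ (l : List (ι × Bool)) (u : FreeGroup ι), l.length < u.toWord.length →
      (u * FreeGroup.mk l).toWord.head? = u.toWord.head? by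
    simpa [FreeGroup.mk_toWord] using H g.toWord u h
  intro l
  induction l with
  | nil => intro u _; rw [← FreeGroup.one_eq_mk, mul_one]
  | cons a l ih =>
    intro u hu
    rw [← List.singleton_append, ← FreeGroup.mul_mk, ← mul_assoc]
    simp only [List.length_cons] at hu
    have hle := length_le_length_mul_add u (FreeGroup.mk [a])
    have h1 : (FreeGroup.mk [a]).toWord.length = 1 := by simp [FreeGroup.toWord_mk]
    rw [ih _ (by omega), head?_mul_mk_singleton a (by omega)]

end FirstLetter

/-! ### Limit points of cylinders -/

section Limit

variable {ι : Type} (St : TreeSetup ι)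

lemma dist_smul_smul_eq (g : FreeGroup ι) (x y : St.Tb) : dist (g • x) (g • y) = dist x y :=
  (St.act_isom g).dist_eq x y

lemma smul_mem_seg (g : FreeGroup ι) {x y p : St.Tb} (h : p ∈ seg x y) :
    g • p ∈ seg (g • x) (g • y) := by
  simpa only [seg, mem_ofPred_eq, dist_smul_smul_eq] using h

lemma connectedSpace_of_isRTree {X : Type*} [MetricSpace X] [IsRTree X] [Nonempty X] :
    ConnectedSpace X := by
  obtain ⟨x₀⟩ := ‹Nonempty X›
  have : PreconnectedSpace X := by
    refine ⟨isPreconnected_closed_iff.2 ?_⟩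
    rintro A B hA hB hAB ⟨a, -, ha⟩ ⟨b, -, hb⟩
    obtain ⟨r, -, hr⟩ := exists_mem_seg_of_isClosed_cover hA hB (univ_subset_iff.1 hAB) ha hb
    exact ⟨r, trivial, hr⟩
  exact ⟨⟨x₀⟩⟩

lemma dense_orbit {P : St.Tb} (hP : P ∈ St.Tsub) :
    Dense (range fun g : FreeGroup ι => g • P) := by
  have := closure_mono (St.dense_orbits P hP)
  rw [St.dense.closure_eq, closure_closure] at this
  exact dense_iff_closure_eq.2 (univ_subset_iff.1 this)

variable [DecidableEq ι]

/-- The limit points in `T̄` of sequences `uₙ P` where `uₙ` tends to infinity in the set of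
reduced words with first letter `z`. -/
def cylinderLimit (P : St.Tb) (z : ι × Bool) : Set St.Tb :=
  {Q | ∀ ε > (0 : ℝ), ∀ n : ℕ, ∃ u : FreeGroup ι,
    n ≤ u.toWord.length ∧ u.toWord.head? = some z ∧ dist (u • P) Q < ε}

lemma isClosed_cylinderLimit (P : St.Tb) (z : ι × Bool) : IsClosed (cylinderLimit St P z) := by
  refine isClosed_of_closure_subset fun Q hQ ε hε n => ?_
  obtain ⟨R, hR, hQR⟩ := Metric.mem_closure_iff.1 hQ (ε / 2) (half_pos hε)
  obtain ⟨u, hn, hz, hu⟩ := hR (ε / 2) (half_pos hε) n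
  have := dist_triangle (u • P) R Q
  rw [dist_comm R Q] at this
  exact ⟨u, hn, hz, by linarith⟩

lemma smul_mem_cylinderLimit {P Q : St.Tb} {y z : ι × Bool} (hQ : Q ∈ cylinderLimit St P y)
    (hyz : y ≠ letterInv z) : FreeGroup.mk [z] • Q ∈ cylinderLimit St P z := by
  intro ε hε n
  obtain ⟨u, hn, hy, hu⟩ := hQ ε hε n
  have hw : (FreeGroup.mk [z] * u).toWord = z :: u.toWord := toWord_mk_mul (by simpa [hy] using hyz)
  refine ⟨FreeGroup.mk [z] * u, ?_, by simp [hw], ?_⟩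
  · rw [hw, List.length_cons]; omega
  · rwa [mul_smul, dist_smul_smul_eq]

lemma exists_long_word [Finite ι] [Nonempty ι] {P : St.Tb} (hP : P ∈ St.Tsub) (Q : St.Tb) {ε : ℝ}
    (hε : 0 < ε) (n : ℕ) :
    ∃ u : FreeGroup ι, n ≤ u.toWord.length ∧ dist (u • P) Q < ε := by
  have := St.tree
  have : Nonempty St.Tb := ⟨P⟩
  rcases subsingleton_or_nontrivial St.Tb with h | h
  · obtain ⟨i⟩ := ‹Nonempty ι›
    exact ⟨FreeGroup.of i ^ n, by simp [FreeGroup.toWord_of_pow],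
      by rwa [Subsingleton.elim (_ • P) Q, dist_self]⟩
  · have := connectedSpace_of_isRTree (X := St.Tb)
    have hfin : {u : FreeGroup ι | u.toWord.length < n}.Finite :=
      (List.finite_length_lt (ι × Bool) n).preimage FreeGroup.toWord_injective.injOn
    have hd := (dense_orbit St hP).sdiff_finite (hfin.image fun u => u • P)
    obtain ⟨_, hR, ⟨u, rfl⟩, hu⟩ := hd.inter_open_nonempty _ Metric.isOpen_ball
      ⟨Q, Metric.mem_ball_self hε⟩
    refine ⟨u, ?_, hR⟩
    by_contra! hlt
    exact hu ⟨u, hlt, rfl⟩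

lemma exists_mem_cylinderLimit [Finite ι] [Nonempty ι] {P : St.Tb} (hP : P ∈ St.Tsub)
    (Q : St.Tb) : ∃ z, Q ∈ cylinderLimit St P z := by
  have := Fintype.ofFinite ι
  by_contra! h
  simp only [cylinderLimit, mem_ofPred_eq, not_forall] at h
  choose ε hε n hn using h
  have hne : (Finset.univ : Finset (ι × Bool)).Nonempty := Finset.univ_nonempty
  obtain ⟨u, hu, hd⟩ := exists_long_word St hP Q
    (ε := Finset.univ.inf' hne ε) (by simpa [Finset.lt_inf'_iff] using fun a b => hε (a, b))
    (Finset.univ.sup n + 1)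
  rcases hw : u.toWord with _ | ⟨z, l⟩
  · simp [hw] at hu
  · refine hn z ⟨u, ?_, by simp [hw], hd.trans_le (Finset.inf'_le _ (Finset.mem_univ z))⟩
    have := Finset.le_sup (f := n) (Finset.mem_univ z)
    omega

lemma mem_cylinderLimit_of_QRel {P Q : St.Tb} (hP : P ∈ St.Tsub) {X : InfWord ι}
    (h : QRel St X Q) : Q ∈ cylinderLimit St P (X.letter 0) := by
  obtain ⟨P', -, u, huX, hu⟩ := h
  intro ε hε n
  obtain ⟨_, hR, g, rfl⟩ := (dense_orbit St hP).inter_open_nonempty _ Metric.isOpen_ball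
    ⟨P', Metric.mem_ball_self (half_pos hε)⟩
  obtain ⟨m, hm1, hm2⟩ := ((huX (n + g.toWord.length + 1)).and
    (hu.eventually (Metric.ball_mem_nhds Q (half_pos hε)))).exists
  have hlen := congrArg List.length hm1
  have hhead := congrArg List.head? hm1
  rw [List.length_take, List.length_ofFn] at hlen
  rw [List.head?_take, if_neg (by omega), List.ofFn_succ, List.head?_cons] at hhead
  refine ⟨u m * g, ?_, ?_, ?_⟩
  · have := length_le_length_mul_add (u m) g
    omega
  · rw [head?_mul_of_length_lt (by omega), hhead]
    rfl
  · have := dist_triangle ((u m * g) • P) (u m • P') Q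
    rw [mul_smul, dist_smul_smul_eq] at this
    have h1 : dist (g • P) P' < ε / 2 := hR
    have h2 : dist (u m • P') Q < ε / 2 := hm2
    rw [mul_smul]
    linarith

lemma exists_QRel_of_mem_cylinderLimit [Finite ι] {P Q : St.Tb} (hP : P ∈ St.Tsub) {z : ι × Bool}
    (h : Q ∈ cylinderLimit St P z) : ∃ X : InfWord ι, X.letter 0 = z ∧ QRel St X Q := by
  choose u hlen hz hd using fun n : ℕ => h (1 / ((n : ℝ) + 1)) (by positivity) n
  let : TopologicalSpace (ι × Bool) := ⊥
  have : DiscreteTopology (ι × Bool) := ⟨rfl⟩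
  obtain ⟨X, -, φ, hφ, hX⟩ := isCompact_univ.tendsto_subseq
    (x := fun n k => (u n).toWord.getD k z) fun _ => mem_univ _
  have hev : ∀ k, ∀ᶠ n in atTop, (u (φ n)).toWord[k]? = some (X k) := by
    intro k
    have h1 : ∀ᶠ n in atTop, (u (φ n)).toWord.getD k z = X k :=
      (tendsto_pi_nhds.1 hX k).eventually_mem (s := {X k}) (by simp)
    filter_upwards [h1, eventually_gt_atTop k] with n hn hk
    have : k < (u (φ n)).toWord.length := hk.trans_le ((hφ.id_le n).trans (hlen _))
    rw [List.getD_eq_getElem _ _ this] at hn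
    rw [List.getElem?_eq_getElem this, hn]
  refine ⟨⟨X, fun k => ?_⟩, ?_, P, hP, u ∘ φ, fun k => ?_, ?_⟩
  · obtain ⟨n, hn, hn'⟩ := ((hev k).and (hev (k + 1))).exists
    obtain ⟨hk, e⟩ := List.getElem?_eq_some_iff.1 hn
    obtain ⟨hk', e'⟩ := List.getElem?_eq_some_iff.1 hn'
    have hred : FreeGroup.IsReduced (u (φ n)).toWord := FreeGroup.isReduced_toWord
    have := List.isChain_iff_getElem.1 hred k hk'
    rw [e, e'] at this
    rintro ⟨h1, h2⟩
    have := this h1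
    rw [h2] at this
    revert this
    cases (X (k + 1)).2 <;> simp
  · obtain ⟨n, hn⟩ := (hev 0).exists
    rw [← List.head?_eq_getElem?, hz] at hn
    exact (Option.some.inj hn).symm
  · have : ∀ᶠ n in atTop, ∀ j < k, (u (φ n)).toWord[j]? = some (X j) :=
      (Finset.range k).eventually_all.2 (fun j _ => hev j) |>.mono
        fun n hn j hj => hn j (Finset.mem_range.2 hj)
    filter_upwards [this] with n hn
    refine List.ext_getElem? fun j => ?_
    rcases lt_or_ge j k with hj | hj
    · rw [List.getElem?_take_of_lt hj]
      simpa [hj] using hn j hj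
    · rw [List.getElem?_eq_none, List.getElem?_eq_none] <;> simp [hj]
  · have h0 : Tendsto (fun n => u n • P) atTop (𝓝 Q) :=
      tendsto_iff_dist_tendsto_zero.2 (squeeze_zero (fun _ => dist_nonneg) (fun n => (hd n).le)
        tendsto_one_div_add_atTop_nhds_zero_nat)
    exact h0.comp hφ.tendsto_atTop

/-- Points lying in two distinct cylinder limits are exactly the points of the limit set. -/
lemma mem_limitSet_iff [Finite ι] {P : St.Tb} (hP : P ∈ St.Tsub) {Q : St.Tb} :
    Q ∈ limitSet St ↔
      ∃ y z, y ≠ z ∧ Q ∈ cylinderLimit St P y ∧ Q ∈ cylinderLimit St P z := by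
  constructor
  · rintro ⟨X, Y, hXY, hX, hY⟩
    exact ⟨_, _, hXY, mem_cylinderLimit_of_QRel St hP hX, mem_cylinderLimit_of_QRel St hP hY⟩
  · rintro ⟨y, z, hyz, hy, hz⟩
    obtain ⟨X, rfl, hX⟩ := exists_QRel_of_mem_cylinderLimit St hP hy
    obtain ⟨Y, rfl, hY⟩ := exists_QRel_of_mem_cylinderLimit St hP hz
    exact ⟨X, Y, hyz, hX, hY⟩

/-- The limit set separates the limit points of distinct cylinders. -/
lemma exists_limitSet_mem_seg [Finite ι] [Nonempty ι] {P : St.Tb} (hP : P ∈ St.Tsub)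
    {a b : St.Tb} {y z : ι × Bool} (hyz : y ≠ z) (ha : a ∈ cylinderLimit St P y)
    (hb : b ∈ cylinderLimit St P z) : ∃ r ∈ limitSet St, r ∈ seg a b := by
  have := St.tree
  obtain ⟨r, hr, hry, hr'⟩ := exists_mem_seg_of_isClosed_cover (isClosed_cylinderLimit St P y)
    (B := ⋃ x ∈ {x | x ≠ y}, cylinderLimit St P x)
    ((toFinite _).isClosed_biUnion fun x _ => isClosed_cylinderLimit St P x)
    (eq_univ_of_forall fun Q => by
      obtain ⟨x, hx⟩ := exists_mem_cylinderLimit St hP Q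
      by_cases hxy : x = y
      · exact Or.inl (hxy ▸ hx)
      · exact Or.inr (mem_biUnion (show x ∈ {x | x ≠ y} from hxy) hx))
    ha (mem_biUnion (show z ∈ {x | x ≠ y} from hyz.symm) hb)
  obtain ⟨x, hx, hrx⟩ := mem_iUnion₂.1 hr'
  exact ⟨r, (mem_limitSet_iff St hP).2 ⟨y, x, Ne.symm hx, hry, hrx⟩, hr⟩

lemma limitSet_nonempty [Fintype ι] (hrank : 2 ≤ Fintype.card ι) : (limitSet St).Nonempty := by
  obtain ⟨P, hP⟩ := St.nonempty
  have : Nontrivial ι := Fintype.one_lt_card_iff_nontrivial.1 hrank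
  obtain ⟨z, hz⟩ := exists_mem_cylinderLimit St hP P
  obtain ⟨i, hi⟩ := exists_ne z.1
  have hz' : FreeGroup.mk [(i, true)] • P ∈ cylinderLimit St P (i, true) :=
    smul_mem_cylinderLimit St hz fun h => hi (congrArg Prod.fst h).symm
  obtain ⟨r, hr, -⟩ := exists_limitSet_mem_seg St hP (fun h => hi (congrArg Prod.fst h)) hz' hz
  exact ⟨r, hr⟩

/-- A non-trivial reduced word maps the limit set into the limits of the cylinder of its
first letter. -/
lemma smul_limitSet_subset_cylinderLimit [Finite ι] {P : St.Tb} (hP : P ∈ St.Tsub) {Q : St.Tb}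
    (hQ : Q ∈ limitSet St) (l : List (ι × Bool)) (z : ι × Bool)
    (hl : FreeGroup.IsReduced (z :: l)) :
    FreeGroup.mk (z :: l) • Q ∈ cylinderLimit St P z := by
  induction l generalizing z with
  | nil =>
    obtain ⟨x, y, hxy, hx, hy⟩ := (mem_limitSet_iff St hP).1 hQ
    by_cases h : x = letterInv z
    · exact smul_mem_cylinderLimit St hy fun h' => hxy (h.trans h'.symm)
    · exact smul_mem_cylinderLimit St hx h
  | cons y l ih =>
    obtain ⟨hzy, hl'⟩ := FreeGroup.isReduced_cons_cons.1 hl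
    rw [← List.singleton_append, ← FreeGroup.mul_mk, mul_smul]
    refine smul_mem_cylinderLimit St (ih y hl') ?_
    rintro rfl
    have := hzy rfl
    simp [letterInv] at this

/-- If `P ∈ K ∩ wK` for the heart `K`, then `P ∈ zK` for the first letter `z` of `w`. -/
lemma inv_smul_mem_heart [Finite ι] {p : St.Tb} {z : ι × Bool}
    {l : List (ι × Bool)} (hl : FreeGroup.IsReduced (z :: l)) (hp : p ∈ heart St)
    (hp' : (FreeGroup.mk (z :: l))⁻¹ • p ∈ heart St) :
    (FreeGroup.mk [z])⁻¹ • p ∈ heart St := by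
  have := St.tree
  obtain ⟨P, hP⟩ := St.nonempty
  have : Nonempty ι := ⟨z.1⟩
  rcases l with _ | ⟨y, l⟩
  · exact hp'
  obtain ⟨hzy, hl'⟩ := FreeGroup.isReduced_cons_cons.1 hl
  obtain ⟨a, ha, a', ha', hpa⟩ := exists_mem_seg_of_mem_subtreeHull hp
  obtain ⟨b, hb, b', hb', hpb⟩ := exists_mem_seg_of_mem_subtreeHull hp'
  have hpb' := smul_mem_seg St (FreeGroup.mk (y :: l)) hpb
  have e : FreeGroup.mk (y :: l) * (FreeGroup.mk (z :: y :: l))⁻¹ = (FreeGroup.mk [z])⁻¹ := by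
    rw [← List.singleton_append (x := z), ← FreeGroup.mul_mk]; group
  rw [← mul_smul, e] at hpb'
  refine mem_subtreeHull_of_separates (smul_mem_seg St _ hpa) hpb' ?_
  have hza : ∀ x ∈ limitSet St, (FreeGroup.mk [z])⁻¹ • x ∈ cylinderLimit St P (letterInv z) := by
    intro x hx
    rw [inv_mk_singleton]
    exact smul_limitSet_subset_cylinderLimit St hP hx [] _ FreeGroup.IsReduced.singleton
  have hyb : ∀ x ∈ limitSet St, FreeGroup.mk (y :: l) • x ∈ cylinderLimit St P y :=
    fun x hx => smul_limitSet_subset_cylinderLimit St hP hx l y hl'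
  have hne : letterInv z ≠ y := by
    rintro rfl
    have := hzy rfl
    simp [letterInv] at this
  rintro x (rfl | rfl) w (rfl | rfl) <;>
    exact exists_limitSet_mem_seg St hP hne (hza _ ‹_›) (hyb _ ‹_›)

end Limit

/-! ### The canonical morphism -/

section CanonicalMorphism

variable {ι : Type} {St : TreeSetup ι}

namespace InducedAssoc

lemma emb_eq_mk_singleton_smul {K : Set St.Tb} (IA : InducedAssoc St K) (z : ι × Bool) (x y : K)
    (h : (y : St.Tb) = (FreeGroup.mk [z])⁻¹ • (x : St.Tb)) :
    IA.emb x = FreeGroup.mk [z] • IA.emb y := by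
  obtain ⟨x, hx⟩ := x
  obtain ⟨y, hy⟩ := y
  obtain ⟨i, _ | _⟩ := z
  · have e : (FreeGroup.mk [(i, false)] : FreeGroup ι) = (FreeGroup.of i)⁻¹ := rfl
    rw [e] at h ⊢
    have hxy : (FreeGroup.of i)⁻¹ • y = x := by rw [inv_smul_eq_iff]; simpa using h
    rw [IA.compat i ⟨y, hy⟩ (by rw [hxy]; exact hx)]
    exact congrArg IA.emb (Subtype.ext hxy.symm)
  · have e : (FreeGroup.mk [(i, true)] : FreeGroup ι) = FreeGroup.of i := rfl
    rw [e] at h ⊢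
    have hxy : (FreeGroup.of i)⁻¹ • x = y := h.symm
    have := IA.compat i ⟨x, hx⟩ (by rw [hxy]; exact hy)
    rw [inv_smul_eq_iff] at this
    rw [this]
    exact congrArg (FreeGroup.of i • IA.emb ·) (Subtype.ext hxy)

lemma emb_eq_smul_of_isReduced [DecidableEq ι] [Finite ι] (IA : InducedAssoc St (heart St))
    (l : List (ι × Bool)) (hl : FreeGroup.IsReduced l) (x y : heart St)
    (h : (y : St.Tb) = (FreeGroup.mk l)⁻¹ • (x : St.Tb)) :
    IA.emb x = FreeGroup.mk l • IA.emb y := by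
  induction l generalizing x with
  | nil =>
    rw [← FreeGroup.one_eq_mk] at h ⊢
    rw [inv_one, one_smul] at h
    rw [one_smul, Subtype.ext h]
  | cons z l ih =>
    have hz := inv_smul_mem_heart St hl x.2 (h ▸ y.2)
    rw [← List.singleton_append, ← FreeGroup.mul_mk] at h ⊢
    rw [mul_inv_rev, mul_smul] at h
    rw [mul_smul, ← ih (hl.infix ⟨[z], [], by simp⟩) ⟨_, hz⟩ h]
    exact IA.emb_eq_mk_singleton_smul z x _ rfl

lemma jmap_smul_emb {K : Set St.Tb} (IA : InducedAssoc St K) (w : FreeGroup ι) (x : K) :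
    IA.jmap (w • IA.emb x) = w • (x : St.Tb) := by
  rw [IA.jmap_equivariant, IA.jmap_emb]

lemma injective_jmap [DecidableEq ι] [Finite ι] (IA : InducedAssoc St (heart St)) :
    Function.Injective IA.jmap := by
  intro p q hpq
  obtain ⟨v, x, rfl⟩ := IA.orbit_meets p
  obtain ⟨w, y, rfl⟩ := IA.orbit_meets q
  rw [jmap_smul_emb, jmap_smul_emb] at hpq
  have := IA.emb_eq_smul_of_isReduced (v⁻¹ * w).toWord FreeGroup.isReduced_toWord x y
    (by rw [FreeGroup.mk_toWord, mul_inv_rev, inv_inv, mul_smul, hpq, inv_smul_smul])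
  rw [this, FreeGroup.mk_toWord, ← mul_smul, mul_inv_cancel_left]

lemma dist_jmap_of_mem_smul_range {K : Set St.Tb} (IA : InducedAssoc St K) {w : FreeGroup ι}
    {p q : IA.TK} (hp : p ∈ w • range IA.emb) (hq : q ∈ w • range IA.emb) :
    dist (IA.jmap p) (IA.jmap q) = dist p q := by
  obtain ⟨_, ⟨x, rfl⟩, rfl⟩ := hp
  obtain ⟨_, ⟨y, rfl⟩, rfl⟩ := hq
  simp only [jmap_smul_emb]
  rw [dist_smul_smul_eq, (IA.act_isom w).dist_eq, IA.emb_isom.dist_eq]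
  rfl

lemma isSubtree_smul_range {K : Set St.Tb} (IA : InducedAssoc St K) (w : FreeGroup ι) :
    IsSubtree (w • range IA.emb) := by
  intro p hp q hq r hr
  rw [mem_smul_set_iff_inv_smul_mem] at hp hq ⊢
  refine IA.emb_subtree _ hp _ hq ?_
  have := fun a b => (IA.act_isom w⁻¹).dist_eq a b
  simp only [seg, mem_ofPred_eq] at hr ⊢
  rw [this, this, this, hr]

/-- An injective `j : T_𝒦 → T̄` is isometric. -/
lemma isometry_jmap_of_injective {K : Set St.Tb} (IA : InducedAssoc St K)
    (hinj : Function.Injective IA.jmap) : Isometry IA.jmap := by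
  have := St.tree
  have := IA.tree
  refine Isometry.of_dist_eq fun p q => ?_
  obtain ⟨f, hf0, hf1, hf⟩ := IsRTree.geodesic p q
  obtain ⟨F, hF⟩ := IA.seg_cover p q
  have hd : 0 ≤ dist p q := dist_nonneg
  let c : ℝ → ℝ := fun t => max 0 (min t (dist p q))
  have hc : Continuous c := by fun_prop
  have hcI : ∀ t, c t ∈ Icc 0 (dist p q) := fun t =>
    ⟨le_max_left _ _, max_le hd (min_le_right _ _)⟩
  have hcid : ∀ t ∈ Icc 0 (dist p q), c t = t := fun t ht => by
    simp only [c]; rw [min_eq_left ht.2, max_eq_right ht.1]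
  have hfc : Continuous (f ∘ c) := by
    have h1 : LipschitzOnWith 1 f (Icc 0 (dist p q)) :=
      LipschitzOnWith.of_dist_le_mul fun s hs t ht => by
        rw [hf s hs t ht, Real.dist_eq]; simp
    exact h1.continuousOn.comp_continuous hc hcI
  have hseg : ∀ r ∈ Icc 0 (dist p q), ∀ s ∈ Icc 0 (dist p q), ∀ t ∈ Icc 0 (dist p q),
      r ≤ s → s ≤ t → f s ∈ seg (f r) (f t) := by
    intro r hr s hs t ht hrs hst
    rw [seg, mem_ofPred_eq, hf r hr s hs, hf s hs t ht, hf r hr t ht,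
      abs_of_nonpos (by linarith), abs_of_nonpos (by linarith), abs_of_nonpos (by linarith)]
    ring
  have m0 : (0 : ℝ) ∈ Icc 0 (dist p q) := ⟨le_rfl, hd⟩
  have m1 : dist p q ∈ Icc 0 (dist p q) := ⟨hd, le_rfl⟩
  have := dist_eq_of_locally_isometric (g := IA.jmap ∘ f ∘ c) (IA.jmap_morphism.1.comp hfc) hd
    ?_ ?_
  · simpa [hcid _ m0, hcid _ m1, hf0, hf1] using this
  · intro s hs t ht hst
    have := hinj hst
    simp only [Function.comp, hcid s hs, hcid t ht] at this
    have h2 := hf s hs t ht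
    rw [this, dist_self, eq_comm, abs_eq_zero] at h2
    linarith
  · intro x hx
    obtain ⟨w, hw⟩ : ∃ w, ∃ᶠ t in 𝓝[>] x, f (c t) ∈ w • range IA.emb := by
      by_contra! h
      have hall : ∀ᶠ t in 𝓝[>] x, ∀ w ∈ F, f (c t) ∉ w • range IA.emb :=
        F.eventually_all.2 fun w _ => h w
      obtain ⟨t, ht⟩ := hall.exists
      have hmem : f (c t) ∈ seg p q := by
        have := hseg 0 m0 (c t) (hcI t) _ m1 (hcI t).1 (hcI t).2
        rwa [hf0, hf1] at this
      obtain ⟨w, hwF, hw⟩ := mem_iUnion₂.1 (hF hmem)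
      exact ht w hwF hw
    obtain ⟨y, hyw, hy⟩ := (hw.and_eventually (Ioc_mem_nhdsGT hx.2)).exists
    have hmem : ∀ t ∈ Ioc x y, t ∈ Icc 0 (dist p q) ∧ f (c t) ∈ w • range IA.emb := by
      intro t ht
      obtain ⟨r, hrw, hr⟩ := (hw.and_eventually (Ioc_mem_nhdsGT ht.1)).exists
      have hrI : r ∈ Icc 0 (dist p q) :=
        ⟨hx.1.trans hr.1.le, hr.2.trans (ht.2.trans hy.2)⟩
      have htI : t ∈ Icc 0 (dist p q) := ⟨hx.1.trans ht.1.le, ht.2.trans hy.2⟩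
      have hyI : y ∈ Icc 0 (dist p q) := ⟨hx.1.trans hy.1.le, hy.2⟩
      refine ⟨htI, IA.isSubtree_smul_range w _ hrw _ hyw ?_⟩
      rw [hcid r hrI, hcid t htI, hcid y hyI]
      exact hseg r hrI t htI y hyI hr.2 ht.2
    refine ⟨y, hy.1, fun s hs t ht => ?_⟩
    obtain ⟨hsI, hsw⟩ := hmem s hs
    obtain ⟨htI, htw⟩ := hmem t ht
    simp only [Function.comp]
    rw [IA.dist_jmap_of_mem_smul_range hsw htw, hcid s hsI, hcid t htI, hf s hsI t htI]

end InducedAssoc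

/-- The image of an isometric embedding of `ℝ`-trees is a subtree. -/
lemma isSubtree_range_of_isometry {X Y : Type*} [MetricSpace X] [MetricSpace Y] [IsRTree X]
    [IsRTree Y] {j : X → Y} (hj : Isometry j) : IsSubtree (range j) := by
  rintro _ ⟨p, rfl⟩ _ ⟨q, rfl⟩ z hz
  obtain ⟨f, hf0, hf1, hf⟩ := IsRTree.geodesic p q
  have hzd := hz
  simp only [seg, mem_ofPred_eq] at hzd
  rw [hj.dist_eq] at hzd
  have h1 : 0 ≤ dist (j p) z := dist_nonneg
  have h2 : 0 ≤ dist z (j q) := dist_nonneg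
  have m0 : (0 : ℝ) ∈ Icc 0 (dist p q) := ⟨le_rfl, dist_nonneg⟩
  have m1 : dist p q ∈ Icc 0 (dist p q) := ⟨dist_nonneg, le_rfl⟩
  have mz : dist (j p) z ∈ Icc 0 (dist p q) := ⟨h1, by linarith⟩
  have e0 := hf 0 m0 _ mz
  have e1 := hf _ mz _ m1
  rw [hf0, zero_sub, abs_neg, abs_of_nonneg h1] at e0
  rw [hf1, abs_of_nonpos (by linarith)] at e1
  refine ⟨f (dist (j p) z), eq_of_mem_seg (x := j p) (y := j q) ?_ hz ?_⟩
  · rw [seg, mem_ofPred_eq, hj.dist_eq, hj.dist_eq, hj.dist_eq]; linarith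
  · rw [hj.dist_eq, e0]

/-- A non-empty invariant subtree of `T̄` contains `T`. -/
lemma Tsub_subset_of_isSubtree {A : Set St.Tb} (hne : A.Nonempty) (hA : IsSubtree A)
    (hinv : ∀ g : FreeGroup ι, ∀ x ∈ A, g • x ∈ A) : St.Tsub ⊆ A := by
  have := St.tree
  suffices h : (A ∩ St.Tsub).Nonempty by
    rw [← St.minimal (A ∩ St.Tsub) inter_subset_right h
      (fun x hx y hy z hz => ⟨hA x hx.1 y hy.1 hz, St.sub_subtree x hx.2 y hy.2 hz⟩)
      (fun g x hx => ⟨hinv g x hx.1, St.invariant g x hx.2⟩)]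
    exact inter_subset_left
  obtain ⟨Q, hQ⟩ := hne
  by_cases hfix : ∀ g : FreeGroup ι, g • Q = Q
  · obtain ⟨P, hP⟩ := St.nonempty
    have hsphere : ∀ x : St.Tb, dist x Q = dist P Q := by
      have hcl : IsClosed {x : St.Tb | dist x Q = dist P Q} :=
        isClosed_eq (by fun_prop) continuous_const
      have hsub : (range fun g : FreeGroup ι => g • P) ⊆ {x : St.Tb | dist x Q = dist P Q} := by
        rintro _ ⟨g, rfl⟩
        change dist (g • P) Q = dist P Q
        conv_lhs => rw [← hfix g]
        exact dist_smul_smul_eq St g P Q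
      intro x
      exact closure_minimal hsub hcl (dense_orbit St hP x)
    have hPQ : P = Q := by
      have := hsphere Q
      rw [dist_self] at this
      exact dist_eq_zero.1 this.symm
    exact ⟨Q, hQ, hPQ ▸ hP⟩
  · push Not at hfix
    obtain ⟨g, hg⟩ := hfix
    have hpos : 0 < dist Q (g • Q) := dist_pos.2 hg.symm
    obtain ⟨f, hf0, hf1, hf⟩ := IsRTree.geodesic Q (g • Q)
    obtain ⟨m, hm1, hm2⟩ : ∃ m, dist Q m = dist Q (g • Q) / 2 ∧
        dist m (g • Q) = dist Q (g • Q) / 2 := by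
      have m0 : (0 : ℝ) ∈ Icc 0 (dist Q (g • Q)) := ⟨le_rfl, hpos.le⟩
      have m1 : dist Q (g • Q) ∈ Icc 0 (dist Q (g • Q)) := ⟨hpos.le, le_rfl⟩
      have mh : dist Q (g • Q) / 2 ∈ Icc 0 (dist Q (g • Q)) := ⟨by linarith, by linarith⟩
      have e0 := hf 0 m0 _ mh
      have e1 := hf _ mh _ m1
      rw [hf0, abs_of_nonpos (by linarith)] at e0
      rw [hf1, abs_of_nonpos (by linarith)] at e1
      exact ⟨f (dist Q (g • Q) / 2), by linarith, by linarith⟩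
    have hm : m ∈ seg Q (g • Q) := by rw [seg, mem_ofPred_eq]; linarith
    obtain ⟨x, hx, hxQ⟩ := St.dense.exists_dist_lt Q (half_pos hpos)
    obtain ⟨y, hy, hyQ⟩ := St.dense.exists_dist_lt (g • Q) (half_pos hpos)
    have far : ∀ {a b : St.Tb}, m ∈ seg a b → dist a m ≤ dist a b := by
      intro a b h
      simp only [seg, mem_ofPred_eq] at h
      linarith [dist_nonneg (x := m) (y := b)]
    have hxy : m ∈ seg x y := by
      rcases mem_seg_or hm x with h | h
      · linarith [far h]
      · rcases mem_seg_or h y with h | h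
        · exact h
        · have := far (mem_seg_comm h)
          rw [dist_comm (g • Q) m] at this
          linarith
    exact ⟨m, hA Q hQ _ (hinv g Q hQ) hm, St.sub_subtree x hx y hy hxy⟩

end CanonicalMorphism

/-- **Corollary 5.6.**  For the system of isometries `𝒦_𝒜 = (K_𝒜, 𝒜)` induced on the
heart `K_𝒜` of `T` with respect to the basis `𝒜`, the canonical equivariant morphism
`j : T_{𝒦_𝒜} → T̄` is an isometric embedding, and its image contains `T`. -/
theorem heart_isometric {ι : Type} [Fintype ι] [DecidableEq ι] (hrank : 2 ≤ Fintype.card ι)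
    (St : TreeSetup ι) (IA : InducedAssoc St (heart St)) :
    Isometry IA.jmap ∧ St.Tsub ⊆ Set.range IA.jmap := by
  have := St.tree
  have := IA.tree
  have hj := IA.isometry_jmap_of_injective IA.injective_jmap
  refine ⟨hj, Tsub_subset_of_isSubtree ?_ (isSubtree_range_of_isometry hj) ?_⟩
  · obtain ⟨Q, hQ⟩ := limitSet_nonempty St hrank
    exact ⟨_, IA.emb ⟨Q, subset_subtreeHull _ hQ⟩, rfl⟩
  · rintro g _ ⟨p, rfl⟩
    exact ⟨g • p, IA.jmap_equivariant g p⟩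

end CHL
end
end

section
/- Let T be an ℝ-tree with a very small, minimal, isometric action of the free group F_N (N ≥ 2) with dense orbits, let 𝒜 be a basis of F_N, let K ⊆ T̄ be a compact subtree with K ∩ aK ≠ ∅ for every a ∈ 𝒜, and let 𝒦 = (K,𝒜) be the induced system of isometries. Then the admissible lamination of 𝒦 is contained in the dual lamination of T; concretely: (i) if X, Y ∈ ∂F_N are admissible infinite words with distinct first letters such that dom(X) ∩ dom(Y) ≠ ∅, then 𝒬(X) = 𝒬(Y), i.e. (X,Y) ∈ L²(T); and consequently (ii) ℒ_adm(𝒦) ⊆ ℒ_𝒜(T). -/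
/-!
Common formalization framework for "ℝ-trees, dual laminations, and compact systems
of partial isometries" (Coulbois–Hilion–Lustig).
-/

open Set Filter Topology Pointwise

noncomputable section

namespace CHL

section Words

open FreeGroup

variable {ι : Type}

theorem InfWord.isReduced_ofFn (X : InfWord ι) (n : ℕ) :
    IsReduced (List.ofFn fun i : Fin n => X.letter i) := by
  rw [FreeGroup.IsReduced, List.isChain_iff_getElem]
  intro i hi h
  simp only [List.getElem_ofFn] at h ⊢
  have := X.reduced i
  unfold LettersInv at this
  revert this
  cases (X.letter i).2 <;> cases (X.letter (i + 1)).2 <;> simp [h]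

variable [DecidableEq ι]

theorem isReduced_invRev {L : List (ι × Bool)} (h : IsReduced L) : IsReduced (invRev L) := by
  rw [isReduced_iff_reduce_eq] at h ⊢
  rw [reduce_invRev, h]

theorem toWord_mk_of_isReduced {L : List (ι × Bool)} (h : IsReduced L) :
    (FreeGroup.mk L).toWord = L := by
  rw [toWord_mk, h.reduce_eq]

/-- Left multiplication by a word of length at most `|A|` does not affect the letters of a
reduced word after its prefix `A`. -/
theorem reduce_append_eq (L A B : List (ι × Bool)) (h : IsReduced (A ++ B))
    (hL : L.length ≤ A.length) :
    ∃ A' : List (ι × Bool), reduce (L ++ A ++ B) = A' ++ B ∧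
      A.length ≤ A'.length + L.length := by
  induction L with
  | nil => exact ⟨A, by simpa using h.reduce_eq, by simp⟩
  | cons x L ih =>
    simp only [List.length_cons] at hL
    obtain ⟨A', h₁, h₂⟩ := ih (by omega)
    obtain ⟨a, A', rfl⟩ : ∃ a l, A' = a :: l := by
      cases A' with
      | nil => simp at h₂; omega
      | cons a l => exact ⟨a, l, rfl⟩
    simp only [List.cons_append, reduce.cons, h₁]
    simp only [List.length_cons] at h₂ ⊢
    split_ifs
    · exact ⟨A', rfl, by omega⟩
    · exact ⟨x :: a :: A', rfl, by simp only [List.length_cons]; omega⟩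

theorem toWord_mul_eq (g x : FreeGroup ι) {A B : List (ι × Bool)} (hx : x.toWord = A ++ B)
    (hg : g.norm ≤ A.length) :
    ∃ A' : List (ι × Bool), (g * x).toWord = A' ++ B ∧ A.length ≤ A'.length + g.norm := by
  rw [toWord_mul, hx, ← List.append_assoc]
  exact reduce_append_eq _ _ _ (hx ▸ isReduced_toWord) hg

/-- Right multiplication by `g` only affects the last `|g|` letters of a word. -/
theorem toWord_mul_eq_append (x g : FreeGroup ι) {A B : List (ι × Bool)}
    (hx : x.toWord = B ++ A) (hg : g.norm ≤ A.length) :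
    ∃ A' : List (ι × Bool), (x * g).toWord = B ++ A' := by
  obtain ⟨A', h, -⟩ := toWord_mul_eq g⁻¹ x⁻¹ (A := invRev A) (B := invRev B)
    (by rw [toWord_inv, hx, invRev_append]) (by simpa using hg)
  refine ⟨invRev A', ?_⟩
  have := congrArg invRev h
  rwa [← toWord_inv, mul_inv_rev, inv_inv, inv_inv, invRev_append, invRev_invRev] at this

theorem take_toWord_letter_mul (a : ι × Bool) {x y : FreeGroup ι} {k : ℕ}
    (h : x.toWord.take (k + 1) = y.toWord.take (k + 1)) :
    (FreeGroup.mk [a] * x).toWord.take k = (FreeGroup.mk [a] * y).toWord.take k := by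
  have key : ∀ z : FreeGroup ι, (FreeGroup.mk [a] * z).toWord = reduce (a :: z.toWord) := by
    intro z
    rw [toWord_mul, toWord_mk, reduce_singleton, List.singleton_append]
  rw [key, key, reduce.cons, reduce.cons, reduce_toWord, reduce_toWord]
  cases hx : x.toWord with
  | nil =>
    cases hy : y.toWord with
    | nil => rfl
    | cons c m => simp [hx, hy] at h
  | cons b l =>
    cases hy : y.toWord with
    | nil => simp [hx, hy] at h
    | cons c m =>
      simp only [hx, hy, List.take_succ_cons, List.cons.injEq] at h
      obtain ⟨rfl, h⟩ := h
      dsimp only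
      split_ifs
      · exact h
      · cases k with
        | zero => rfl
        | succ k =>
          cases k with
          | zero => rfl
          | succ k =>
            have h' : l.take k = m.take k := by
              have := congrArg (List.take k) h
              simpa [List.take_take, show min k (k + 1 + 1) = k by omega] using this
            simp [h']

theorem take_toWord_mul (g : FreeGroup ι) {x y : FreeGroup ι} {k : ℕ}
    (h : x.toWord.take (k + g.norm) = y.toWord.take (k + g.norm)) :
    (g * x).toWord.take k = (g * y).toWord.take k := by
  have key : ∀ (L : List (ι × Bool)) (k : ℕ),
      x.toWord.take (k + L.length) = y.toWord.take (k + L.length) →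
      (FreeGroup.mk L * x).toWord.take k = (FreeGroup.mk L * y).toWord.take k := by
    intro L
    induction L with
    | nil => intro k h; simpa [← FreeGroup.one_eq_mk] using h
    | cons a L ih =>
      intro k h
      have e : FreeGroup.mk (a :: L) = FreeGroup.mk [a] * FreeGroup.mk L := by simp [mul_mk]
      rw [e, mul_assoc, mul_assoc]
      refine take_toWord_letter_mul a (ih (k + 1) ?_)
      rwa [List.length_cons, show k + (L.length + 1) = k + 1 + L.length by omega] at h
  simpa [mk_toWord] using key g.toWord k h

theorem take_eq_of_le {α : Type*} {l m : List α} {j k : ℕ} (hjk : j ≤ k)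
    (h : l.take k = m.take k) : l.take j = m.take j := by
  have := congrArg (List.take j) h
  simpa [List.take_take, min_eq_left hjk] using this

theorem exists_common_prefix {α : Type*} (a b : List α) :
    ∃ c a' b' : List α, a = c ++ a' ∧ b = c ++ b' ∧ ∀ x ∈ a'.head?, ∀ y ∈ b'.head?, x ≠ y := by
  induction a generalizing b with
  | nil => exact ⟨[], [], b, rfl, rfl, by simp⟩
  | cons x a ih =>
    cases b with
    | nil => exact ⟨[], x :: a, [], rfl, rfl, by simp⟩
    | cons y b =>
      by_cases hxy : x = y
      · obtain ⟨c, a', b', rfl, rfl, h⟩ := ih b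
        exact ⟨x :: c, a', b', rfl, by rw [hxy]; rfl, h⟩
      · exact ⟨[], x :: a, y :: b, rfl, rfl, by simpa using hxy⟩

/-- If `t` is long compared to `r` and shares only a short prefix with `r t`, then the last
letter of `t` survives at both ends of `t⁻¹ r t`. -/
theorem toWord_conj_eq {t r : FreeGroup ι} {M : ℕ} (ht : t.norm = 2 * M + 1) (hr : r.norm ≤ M)
    (hne : t.toWord.take M ≠ (r * t).toWord.take M) :
    ∃ (t' μ : List (ι × Bool)) (e : ι × Bool), t.toWord = t' ++ [e] ∧
      (t⁻¹ * r * t).toWord = (e.1, !e.2) :: (μ ++ [e]) := by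
  have ht' : t.toWord.length = 2 * M + 1 := ht
  obtain ⟨t', e, hte⟩ : ∃ t' e, t.toWord = t' ++ [e] := by
    rcases List.eq_nil_or_concat t.toWord with h | ⟨l, a, h⟩
    · simp [h] at ht'
    · exact ⟨l, a, by simpa using h⟩
  have hlen : t'.length = 2 * M := by
    rw [hte, List.length_append, List.length_singleton] at ht'
    omega
  obtain ⟨b₀, hb, hb₀⟩ := toWord_mul_eq r t hte (by omega)
  obtain ⟨c, a', b', h₁, h₂, hhd⟩ := exists_common_prefix t.toWord (r * t).toWord
  have hc : c.length < M := by
    by_contra hc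
    apply hne
    rw [h₁, h₂, List.take_append_of_le_length (by omega),
      List.take_append_of_le_length (by omega)]
  have last : ∀ (l l' : List (ι × Bool)), l ++ [e] = c ++ l' → c.length < l.length + 1 →
      ∃ m, l' = m ++ [e] := by
    intro l l' h hl
    rcases List.eq_nil_or_concat l' with rfl | ⟨m, x, rfl⟩
    · have := congrArg List.length h
      simp at this
      omega
    · refine ⟨m, ?_⟩
      rw [List.concat_eq_append, ← List.append_assoc] at h
      have := (List.append_inj' h rfl).2
      simp_all
  obtain ⟨α, rfl⟩ := last t' a' (by rw [← hte, h₁]) (by omega)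
  obtain ⟨β, rfl⟩ := last b₀ b' (by rw [← hb, h₂]) (by omega)
  have hred : IsReduced (invRev (α ++ [e]) ++ (β ++ [e])) := by
    have ha : IsReduced (α ++ [e]) :=
      (isReduced_toWord (x := t)).infix ⟨c, [], by rw [h₁]; simp⟩
    have hb : IsReduced (β ++ [e]) :=
      (isReduced_toWord (x := r * t)).infix ⟨c, [], by rw [h₂]; simp⟩
    refine List.IsChain.append (isReduced_invRev ha) hb ?_
    intro x hx y hy hxy
    have : (x.1, !x.2) ∈ (α ++ [e]).head? := by
      revert hx
      generalize α ++ [e] = l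
      cases l with
      | nil => simp
      | cons z l =>
        rw [invRev_cons]
        simp [invRev]
        rintro rfl
        simp
    have := hhd _ this y hy
    by_contra hn
    apply this
    ext
    · exact hxy
    · revert hn
      cases x.2 <;> cases y.2 <;> simp
  refine ⟨t', invRev α ++ β, e, hte, ?_⟩
  have e₁ : t = FreeGroup.mk c * FreeGroup.mk (α ++ [e]) := by
    rw [mul_mk, ← h₁, mk_toWord]
  have e₂ : r * t = FreeGroup.mk c * FreeGroup.mk (β ++ [e]) := by
    rw [mul_mk, ← h₂, mk_toWord]
  have e₃ : t⁻¹ * r * t = FreeGroup.mk (invRev (α ++ [e]) ++ (β ++ [e])) := by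
    rw [mul_assoc, e₂, e₁, ← mul_mk (L₁ := invRev _), ← inv_mk]
    group
  rw [e₃, toWord_mk_of_isReduced hred, invRev_append]
  simp [invRev]

/-- The elements of a generating set cannot all fix a long prefix of a given reduced word. -/
theorem exists_take_ne (hι : 2 ≤ Nat.card ι) (G : Set (FreeGroup ι))
    (hG : Subgroup.closure G = ⊤) :
    ∃ M : ℕ, ∀ t : FreeGroup ι, t ≠ 1 →
      ∃ r ∈ G, r.norm ≤ M ∧ t.toWord.take M ≠ (r * t).toWord.take M := by
  have key : ∀ g : FreeGroup ι, ∀ j : ℕ, ∃ M : ℕ, ∀ t : FreeGroup ι,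
      (∀ r ∈ G, r.norm ≤ M → t.toWord.take M = (r * t).toWord.take M) →
      t.toWord.take j = (g * t).toWord.take j := by
    intro g
    have hg : g ∈ Subgroup.closure G := by rw [hG]; trivial
    induction hg using Subgroup.closure_induction with
    | mem g hg =>
      intro j
      exact ⟨max j g.norm, fun t ht =>
        take_eq_of_le (le_max_left _ _) (ht g hg (le_max_right _ _))⟩
    | one => exact fun j => ⟨0, fun t _ => by rw [one_mul]⟩
    | mul g h _ _ ihg ihh =>
      intro j
      obtain ⟨M₁, h₁⟩ := ihg j
      obtain ⟨M₂, h₂⟩ := ihh (j + g.norm)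
      refine ⟨max M₁ M₂, fun t ht => ?_⟩
      rw [h₁ t fun r hr hn => take_eq_of_le (le_max_left _ _)
        (ht r hr (hn.trans (le_max_left _ _))), mul_assoc]
      exact take_toWord_mul g (h₂ t fun r hr hn => take_eq_of_le (le_max_right _ _)
        (ht r hr (hn.trans (le_max_right _ _))))
    | inv g _ ih =>
      intro j
      obtain ⟨M, h⟩ := ih (j + g⁻¹.norm)
      refine ⟨M, fun t ht => ?_⟩
      have := take_toWord_mul g⁻¹ (h t ht)
      rw [inv_mul_cancel_left] at this
      exact this.symm
  have : Nontrivial ι := by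
    have : Finite ι := Nat.finite_of_card_ne_zero (by omega)
    exact Finite.one_lt_card_iff_nontrivial.mp (by omega)
  obtain ⟨i, i', hii⟩ := exists_pair_ne ι
  obtain ⟨M₁, h₁⟩ := key (FreeGroup.of i) 1
  obtain ⟨M₂, h₂⟩ := key (FreeGroup.of i') 1
  refine ⟨max M₁ M₂, fun t ht => ?_⟩
  by_contra! hcon
  have hfst : ∀ i₀ : ι, t.toWord.take 1 = (FreeGroup.of i₀ * t).toWord.take 1 →
      ∃ b, t.toWord.head? = some (i₀, b) := by
    intro i₀ h
    rw [toWord_mul, toWord_of, List.singleton_append, reduce.cons, reduce_toWord] at h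
    cases hw : t.toWord with
    | nil => exact absurd (toWord_eq_nil_iff.mp hw) ht
    | cons x l =>
      rw [hw] at h
      dsimp only at h
      split_ifs at h with hx
      · exact ⟨x.2, by rw [hx.1]; rfl⟩
      · simp only [List.take_succ_cons, List.take_zero, List.cons.injEq, and_true] at h
        exact ⟨true, by rw [h]; rfl⟩
  obtain ⟨b, hb⟩ := hfst i (h₁ t fun r hr hn => take_eq_of_le (le_max_left _ _)
    (hcon r hr (hn.trans (le_max_left _ _))))
  obtain ⟨b', hb'⟩ := hfst i' (h₂ t fun r hr hn => take_eq_of_le (le_max_right _ _)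
    (hcon r hr (hn.trans (le_max_right _ _))))
  rw [hb] at hb'
  simp only [Option.some.injEq, Prod.mk.injEq] at hb'
  exact hii hb'.1

theorem InfWord.toWord_prefixN (X : InfWord ι) (n : ℕ) :
    (X.prefixN n).toWord = List.ofFn fun i : Fin n => X.letter i :=
  toWord_mk_of_isReduced (X.isReduced_ofFn n)

theorem InfWord.take_prefixN_mul (X : InfWord ι) (g : FreeGroup ι) {n k : ℕ}
    (h : k + g.norm ≤ n) :
    (X.prefixN n * g).toWord.take k = List.ofFn fun i : Fin k => X.letter i := by
  obtain ⟨m, rfl⟩ : ∃ m, n = k + m := ⟨n - k, by omega⟩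
  obtain ⟨A', hA'⟩ := toWord_mul_eq_append (X.prefixN (k + m)) g
    (B := List.ofFn fun i : Fin k => X.letter i)
    (A := List.ofFn fun i : Fin m => X.letter (k + i))
    (by rw [X.toWord_prefixN, List.ofFn_add]; rfl)
    (by rw [List.length_ofFn]; omega)
  rw [hA', List.take_left' (List.length_ofFn)]

/-- The word `m ρ₁ m⁻¹ ρ₂` is cyclically reduced as soon as all its seams are reduced. -/
theorem exists_cyclicallyReduced {d c e₁ e₂ : ι × Bool} {w μ₁ μ₂ : List (ι × Bool)}
    (h₁ : IsReduced (d :: (w ++ [c]) ++ [(e₁.1, !e₁.2)]))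
    (h₂ : IsReduced ([e₂] ++ d :: (w ++ [c])))
    (hρ₁ : IsReduced ((e₁.1, !e₁.2) :: (μ₁ ++ [e₁])))
    (hρ₂ : IsReduced ((e₂.1, !e₂.2) :: (μ₂ ++ [e₂]))) :
    ∃ u w' : FreeGroup ι,
      (u * FreeGroup.mk w * w').toWord = u.toWord ++ w ++ w'.toWord ∧
      IsCyclicallyReduced (u * FreeGroup.mk w * w') ∧
      u * FreeGroup.mk w * w' = FreeGroup.mk (d :: (w ++ [c])) *
        FreeGroup.mk ((e₁.1, !e₁.2) :: (μ₁ ++ [e₁])) * (FreeGroup.mk (d :: (w ++ [c])))⁻¹ *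
        FreeGroup.mk ((e₂.1, !e₂.2) :: (μ₂ ++ [e₂])) := by
  obtain ⟨m, hm⟩ : ∃ m, m = d :: (w ++ [c]) := ⟨_, rfl⟩
  have h₁' : IsReduced ([e₁] ++ invRev m) := by
    have := isReduced_invRev h₁
    rw [← hm, invRev_append] at this
    simpa [invRev] using this
  have h₂' : IsReduced (invRev m ++ [(e₂.1, !e₂.2)]) := by
    have := isReduced_invRev h₂
    rw [← hm, invRev_append] at this
    simpa [invRev] using this
  rw [← hm] at h₁ h₂
  have hne : invRev m ≠ [] := by simp [hm, invRev]
  have hA : IsReduced (m ++ (e₁.1, !e₁.2) :: (μ₁ ++ [e₁])) := by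
    simpa using IsReduced.append_overlap (L₃ := μ₁ ++ [e₁]) h₁ hρ₁ (by simp)
  have hB : IsReduced ((m ++ (e₁.1, !e₁.2) :: μ₁) ++ [e₁] ++ invRev m) :=
    IsReduced.append_overlap (by simpa using hA) h₁' (by simp)
  have hC := IsReduced.append_overlap hB h₂' hne
  have hD := IsReduced.append_overlap (L₃ := μ₂ ++ [e₂]) hC hρ₂ (by simp)
  obtain ⟨w', hw'⟩ : ∃ w', w' = [c] ++ (e₁.1, !e₁.2) :: (μ₁ ++ [e₁]) ++ invRev m ++
    (e₂.1, !e₂.2) :: (μ₂ ++ [e₂]) := ⟨_, rfl⟩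
  have hE : IsReduced ([d] ++ w ++ w') := by
    have e : [d] ++ w ++ w' = (m ++ (e₁.1, !e₁.2) :: μ₁) ++ [e₁] ++ invRev m ++
        [(e₂.1, !e₂.2)] ++ (μ₂ ++ [e₂]) := by
      rw [hw']
      conv_rhs => rw [hm]
      simp [hm]
    rw [e]; exact hD
  have hmul : FreeGroup.mk [d] * FreeGroup.mk w * FreeGroup.mk w' =
      FreeGroup.mk ([d] ++ w ++ w') := by rw [mul_mk, mul_mk]
  refine ⟨FreeGroup.mk [d], FreeGroup.mk w', ?_, ⟨?_, ?_⟩, ?_⟩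
  · rw [hmul, toWord_mk_of_isReduced hE, toWord_mk_of_isReduced IsReduced.singleton,
      toWord_mk_of_isReduced (hE.infix ⟨[d] ++ w, [], by simp⟩)]
  · intro h
    have := congrArg toWord h
    rw [hmul, toWord_mk_of_isReduced hE, toWord_one] at this
    simp at this
  · rw [hmul, toWord_mk_of_isReduced hE]
    intro a ha b hb
    obtain rfl : d = a := by simpa using ha
    obtain rfl : e₂ = b := by
      have e : [d] ++ w ++ w' = [d] ++ w ++ ([c] ++ (e₁.1, !e₁.2) :: (μ₁ ++ [e₁]) ++
          invRev m ++ (e₂.1, !e₂.2) :: μ₂) ++ [e₂] := by rw [hw']; simp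
      rw [e, List.getLast?_concat] at hb
      simpa using hb
    rw [hm] at h₂
    have := (isReduced_cons_cons.mp h₂).1
    rintro ⟨h, h'⟩
    have := this h.symm
    rw [this] at h'
    revert h'
    cases d.2 <;> simp
  · rw [hmul, mul_mk, inv_mk, mul_mk, mul_mk, ← hm, hw']
    congr 1
    rw [hm]
    simp

end Words

section Tree

theorem preconnectedSpace_of_isRTree (T : Type*) [MetricSpace T] [IsRTree T] :
    PreconnectedSpace T := by
  refine ⟨isPreconnected_of_forall_pair fun x _ y _ => ?_⟩
  obtain ⟨f, h₀, h₁, hf⟩ := IsRTree.geodesic x y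
  refine ⟨f '' Set.Icc 0 (dist x y), Set.subset_univ _,
    ⟨0, by simp, h₀⟩, ⟨dist x y, by simp, h₁⟩, ?_⟩
  refine isPreconnected_Icc.image f (LipschitzOnWith.continuousOn (K := 1) ?_)
  refine LipschitzOnWith.of_dist_le_mul fun s hs t ht => ?_
  rw [hf s hs t ht, Real.dist_eq]
  simp

/-- If an isometric action on a connected space has a dense orbit, then the group is generated
by the elements that move a point of that orbit a little. -/
theorem closure_displacement_lt_eq_top {G T : Type*} [Group G] [MetricSpace T] [MulAction G T]
    [PreconnectedSpace T] (hiso : ∀ g : G, Isometry fun x : T => g • x) (b : T)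
    (hb : ∀ (q : T) (δ : ℝ), 0 < δ → ∃ g : G, dist (g • b) q < δ) {ε : ℝ} (hε : 0 < ε) :
    Subgroup.closure {r : G | dist (r • b) b < ε} = ⊤ := by
  set H := Subgroup.closure {r : G | dist (r • b) b < ε}
  have hopen : ∀ A : Set G, IsOpen {q : T | ∃ g ∈ A, dist (g • b) q < ε / 2} := by
    intro A
    have : {q : T | ∃ g ∈ A, dist (g • b) q < ε / 2} = ⋃ g ∈ A, Metric.ball (g • b) (ε / 2) := by
      ext q
      simp [dist_comm]
    rw [this]
    exact isOpen_biUnion fun g _ => Metric.isOpen_ball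
  have hdisj : ∀ g h : G, ∀ q : T, h ∈ H → dist (h • b) q < ε / 2 → dist (g • b) q < ε / 2 →
      g ∈ H := by
    intro g h q hh h₁ h₂
    have h₃ : dist ((h⁻¹ * g) • b) b < ε := by
      have e := (hiso h).dist_eq ((h⁻¹ * g) • b) b
      simp only [smul_smul, mul_inv_cancel_left] at e
      rw [← e]
      have := dist_triangle_right (g • b) (h • b) q
      linarith
    have := H.mul_mem hh (Subgroup.subset_closure h₃)
    rwa [mul_inv_cancel_left] at this
  have hclopen : IsClopen {q : T | ∃ g ∈ (H : Set G), dist (g • b) q < ε / 2} := by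
    refine ⟨⟨?_⟩, hopen _⟩
    have : {q : T | ∃ g ∈ (H : Set G), dist (g • b) q < ε / 2}ᶜ =
        {q : T | ∃ g ∈ (H : Set G)ᶜ, dist (g • b) q < ε / 2} := by
      ext q
      constructor
      · intro hq
        obtain ⟨g, hg⟩ := hb q (ε / 2) (by positivity)
        exact ⟨g, fun hgH => hq ⟨g, hgH, hg⟩, hg⟩
      · rintro ⟨g, hg, hgq⟩ ⟨h, hh, hhq⟩
        exact hg (hdisj g h q hh hhq hgq)
    rw [this]
    exact hopen _
  have huniv := hclopen.eq_univ ⟨b, 1, H.one_mem, by simpa using hε⟩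
  rw [eq_top_iff]
  intro g _
  obtain ⟨h, hh, hhg⟩ : g • b ∈ {q : T | ∃ g ∈ (H : Set G), dist (g • b) q < ε / 2} := by
    rw [huniv]; trivial
  exact hdisj g h (g • b) hh hhg (by simpa using hε)

variable {ι : Type} (St : TreeSetup ι)

theorem TreeSetup.exists_smul_dist_lt (b q : St.Tb) {δ : ℝ} (hδ : 0 < δ) :
    ∃ g : FreeGroup ι, dist (g • b) q < δ := by
  obtain ⟨b', hb', hbb⟩ := St.dense.exists_dist_lt b (show 0 < δ / 3 by positivity)
  obtain ⟨q', hq', hqq⟩ := St.dense.exists_dist_lt q (show 0 < δ / 3 by positivity)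
  obtain ⟨_, ⟨g, rfl⟩, hg⟩ := Metric.mem_closure_iff.mp (St.dense_orbits b' hb' hq') (δ / 3)
    (by positivity)
  refine ⟨g, ?_⟩
  have h₁ : dist (g • b) (g • b') = dist b b' := (St.act_isom g).dist_eq b b'
  have h₂ := dist_triangle4 (g • b) (g • b') q' q
  rw [dist_comm q' q, dist_comm (g • b') q'] at h₂
  linarith

theorem TreeSetup.translationLengthOn_lt {z : FreeGroup ι} {q : St.Tb} {ε : ℝ}
    (h : dist q (z • q) < ε) : translationLengthOn St.Tsub z < ε := by
  obtain ⟨x, hx, hxq⟩ := St.dense.exists_dist_lt q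
    (show 0 < (ε - dist q (z • q)) / 2 by linarith)
  refine lt_of_le_of_lt (ciInf_le ⟨0, ?_⟩ (⟨x, hx⟩ : St.Tsub)) ?_
  · rintro _ ⟨y, rfl⟩
    exact dist_nonneg
  · have h₁ : dist (z • q) (z • x) = dist q x := (St.act_isom z).dist_eq q x
    have h₂ := dist_triangle4 x q (z • q) (z • x)
    rw [dist_comm x q] at h₂
    show dist x (z • x) < ε
    linarith

variable [DecidableEq ι]

/-- Over a compact set, a uniform bound on the length of words with small displacement which
do not fix a long prefix of a given word. -/
theorem TreeSetup.exists_uniform_small_displacement (hι : 2 ≤ Nat.card ι) {K : Set St.Tb}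
    (hK : IsCompact K) {ε : ℝ} (hε : 0 < ε) :
    ∃ M : ℕ, ∀ y ∈ K, ∀ t : FreeGroup ι, t ≠ 1 → ∃ r : FreeGroup ι,
      dist (r • y) y < ε ∧ r.norm ≤ M ∧ t.toWord.take M ≠ (r * t).toWord.take M := by
  have := St.tree
  have := preconnectedSpace_of_isRTree St.Tb
  refine IsCompact.induction_on hK (p := fun s => ∃ M : ℕ, ∀ y ∈ s, ∀ t : FreeGroup ι, t ≠ 1 →
    ∃ r : FreeGroup ι, dist (r • y) y < ε ∧ r.norm ≤ M ∧
      t.toWord.take M ≠ (r * t).toWord.take M) ⟨0, by simp⟩ ?_ ?_ ?_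
  · rintro s t hst ⟨M, hM⟩
    exact ⟨M, fun y hy => hM y (hst hy)⟩
  · rintro s s' ⟨M₁, h₁⟩ ⟨M₂, h₂⟩
    refine ⟨max M₁ M₂, fun y hy t ht => ?_⟩
    rcases hy with hy | hy
    · obtain ⟨r, hr, hn, hne⟩ := h₁ y hy t ht
      exact ⟨r, hr, hn.trans (le_max_left _ _), fun h => hne (take_eq_of_le (le_max_left _ _) h)⟩
    · obtain ⟨r, hr, hn, hne⟩ := h₂ y hy t ht
      exact ⟨r, hr, hn.trans (le_max_right _ _),
        fun h => hne (take_eq_of_le (le_max_right _ _) h)⟩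
  · intro b _
    obtain ⟨M, hM⟩ := exists_take_ne hι _ (closure_displacement_lt_eq_top St.act_isom b
      (fun q δ hδ => St.exists_smul_dist_lt b q hδ) (show 0 < ε / 3 by positivity))
    refine ⟨Metric.ball b (ε / 3),
      mem_nhdsWithin_of_mem_nhds (Metric.ball_mem_nhds b (by positivity)), M,
      fun y hy t ht => ?_⟩
    obtain ⟨r, hr, hn, hne⟩ := hM t ht
    refine ⟨r, ?_, hn, hne⟩
    have h₁ : dist (r • y) (r • b) = dist y b := (St.act_isom r).dist_eq y b
    have h₂ := dist_triangle4 (r • y) (r • b) b y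
    rw [dist_comm b y] at h₂
    have h₃ : dist (r • b) b < ε / 3 := hr
    have h₄ : dist y b < ε / 3 := hy
    linarith

/-- A point in the domain of an infinite word `X` is the image of `X` under `𝒬`. -/
theorem qRel_of_mem_inducedDomInf {K : Set St.Tb} (hK : IsCompact K) {X : InfWord ι} {x : St.Tb}
    (hx : x ∈ inducedDomInf St K X) : QRel St X x := by
  obtain ⟨P, hP⟩ := St.nonempty
  have hmem : ∀ n, (X.prefixN n)⁻¹ • x ∈ K := fun n =>
    Set.mem_smul_set_iff_inv_smul_mem.mp (Set.mem_iInter.mp hx n)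
  obtain ⟨y, -, φ, hφ, hlim⟩ := hK.tendsto_subseq hmem
  have key : ∀ k : ℕ, ∃ u : FreeGroup ι,
      (∀ j ≤ k, u.toWord.take j = List.ofFn fun i : Fin j => X.letter i) ∧
      dist (u • P) x < 1 / ((k : ℝ) + 1) := by
    intro k
    have hδ : (0 : ℝ) < 1 / ((k : ℝ) + 1) / 2 := by positivity
    obtain ⟨g, hg⟩ := St.exists_smul_dist_lt P y hδ
    obtain ⟨n, hn, hnk⟩ := ((Metric.tendsto_nhds.mp hlim _ hδ).and
      (eventually_ge_atTop (k + g.norm))).exists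
    refine ⟨X.prefixN (φ n) * g, fun j hj => X.take_prefixN_mul g ?_, ?_⟩
    · have := hφ.id_le n
      simp only [id] at this
      omega
    · have h₁ := (St.act_isom (X.prefixN (φ n))⁻¹).dist_eq ((X.prefixN (φ n) * g) • P) x
      simp only [smul_smul, inv_mul_cancel_left] at h₁
      rw [← h₁]
      have h₂ := dist_triangle_right (g • P) ((X.prefixN (φ n))⁻¹ • x) y
      simp only [Function.comp] at hn
      linarith
  choose u hu hdist using key
  refine ⟨P, hP, u, fun j => ?_, ?_⟩
  · filter_upwards [eventually_ge_atTop j] with k hk using hu k j hk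
  · rw [tendsto_iff_dist_tendsto_zero]
    exact squeeze_zero (fun _ => dist_nonneg) (fun k => (hdist k).le)
      tendsto_one_div_add_atTop_nhds_zero_nat

/-- A word with long admissible extensions on both sides belongs to the dual language. -/
theorem inducedAdmLanguage_subset_dualLanguageOn (hι : 2 ≤ Nat.card ι) {K : Set St.Tb}
    (hK : IsCompact K) : inducedAdmLanguage St K ⊆ dualLanguageOn ι St.Tsub := by
  intro w hw ε hε
  obtain ⟨M, hM⟩ := St.exists_uniform_small_displacement hι hK (show 0 < ε / 2 by positivity)
  obtain ⟨v, ⟨x, hx⟩, p, s, hp, hs, hv⟩ := hw (2 * M + 2)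
  have hxn : ∀ n ≤ v.toWord.length, x ∈ gprefix v n • K := by
    intro n hn
    exact Set.mem_iInter₂.mp hx n (Finset.mem_range.mpr (by omega))
  have hxK : x ∈ K := by
    have := hxn 0 (Nat.zero_le _)
    rwa [gprefix, List.take_zero, ← FreeGroup.one_eq_mk, one_smul] at this
  have hyK : v⁻¹ • x ∈ K := by
    have := hxn _ le_rfl
    rwa [gprefix, List.take_length, FreeGroup.mk_toWord,
      Set.mem_smul_set_iff_inv_smul_mem] at this
  obtain ⟨p₀, d, rfl⟩ : ∃ p₀ d, p = p₀ ++ [d] := by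
    rcases List.eq_nil_or_concat p with rfl | ⟨l, a, h⟩
    · simp at hp
    · exact ⟨l, a, by simpa using h⟩
  obtain ⟨c, s₀, rfl⟩ : ∃ c s₀, s = c :: s₀ := by
    cases s with
    | nil => simp at hs
    | cons c s₀ => exact ⟨c, s₀, rfl⟩
  have hvred : FreeGroup.IsReduced (p₀ ++ [d] ++ w.toWord ++ c :: s₀) :=
    hv ▸ FreeGroup.isReduced_toWord
  have hp₀ : FreeGroup.IsReduced p₀ :=
    hvred.infix ⟨[], [d] ++ w.toWord ++ c :: s₀, by simp⟩
  have hs₀ : FreeGroup.IsReduced (FreeGroup.invRev s₀) :=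
    isReduced_invRev (hvred.infix ⟨p₀ ++ [d] ++ w.toWord ++ [c], [], by simp⟩)
  have hpw := toWord_mk_of_isReduced hp₀
  have hsw := toWord_mk_of_isReduced hs₀
  have hpn : (FreeGroup.mk p₀).norm = 2 * M + 1 := by
    rw [FreeGroup.norm, hpw]; simpa using hp
  have hsn : (FreeGroup.mk (FreeGroup.invRev s₀)).norm = 2 * M + 1 := by
    rw [FreeGroup.norm, hsw, FreeGroup.invRev_length]; simpa using hs
  obtain ⟨r₁, hd₁, hn₁, hne₁⟩ := hM _ hyK (FreeGroup.mk (FreeGroup.invRev s₀))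
    (by rw [Ne, ← FreeGroup.norm_eq_zero]; omega)
  obtain ⟨r₂, hd₂, hn₂, hne₂⟩ := hM _ hxK (FreeGroup.mk p₀)
    (by rw [Ne, ← FreeGroup.norm_eq_zero]; omega)
  obtain ⟨t₁, μ₁, e₁, ht₁, hρ₁⟩ := toWord_conj_eq hsn hn₁ hne₁
  obtain ⟨t₂, μ₂, e₂, ht₂, hρ₂⟩ := toWord_conj_eq hpn hn₂ hne₂
  rw [hsw] at ht₁
  rw [hpw] at ht₂
  have hs₁ : s₀ = (e₁.1, !e₁.2) :: FreeGroup.invRev t₁ := by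
    have := congrArg FreeGroup.invRev ht₁
    rw [FreeGroup.invRev_invRev, FreeGroup.invRev_append] at this
    simpa [FreeGroup.invRev] using this
  obtain ⟨u, w', h₁, h₂, h₃⟩ := exists_cyclicallyReduced (d := d) (c := c) (e₁ := e₁)
    (e₂ := e₂) (w := w.toWord) (μ₁ := μ₁) (μ₂ := μ₂)
    (hvred.infix ⟨p₀, FreeGroup.invRev t₁, by simp [hs₁]⟩)
    (hvred.infix ⟨t₂, s₀, by simp [ht₂]⟩)
    (hρ₁ ▸ FreeGroup.isReduced_toWord) (hρ₂ ▸ FreeGroup.isReduced_toWord)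
  rw [FreeGroup.mk_toWord] at h₁ h₂ h₃
  refine ⟨u, w', h₁, h₂, ?_⟩
  set t := FreeGroup.mk p₀
  have hz : u * w * w' = t⁻¹ * (v * r₁ * v⁻¹ * r₂) * t := by
    have hv' : v = t * FreeGroup.mk (d :: (w.toWord ++ [c])) *
        (FreeGroup.mk (FreeGroup.invRev s₀))⁻¹ := by
      rw [FreeGroup.inv_mk, FreeGroup.invRev_invRev, FreeGroup.mul_mk, FreeGroup.mul_mk,
        ← FreeGroup.mk_toWord (x := v), hv]
      simp
    rw [h₃, ← hρ₁, ← hρ₂, FreeGroup.mk_toWord, FreeGroup.mk_toWord, hv']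
    group
  refine St.translationLengthOn_lt (q := (t⁻¹ * r₂⁻¹) • x) ?_
  have hzq : (u * w * w') • (t⁻¹ * r₂⁻¹) • x = t⁻¹ • v • r₁ • v⁻¹ • x := by
    rw [hz]
    simp only [smul_smul]
    congr 1
    group
  have i₁ : dist ((t⁻¹ * r₂⁻¹) • x) (t⁻¹ • x) = dist (r₂ • x) x := by
    have := (St.act_isom (r₂ * t)).dist_eq ((t⁻¹ * r₂⁻¹) • x) (t⁻¹ • x)
    simp only [smul_smul] at this
    rw [← this, dist_comm]
    simp [mul_assoc]
  have i₂ : dist (t⁻¹ • x) (t⁻¹ • v • r₁ • v⁻¹ • x) = dist (r₁ • v⁻¹ • x) (v⁻¹ • x) := by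
    rw [dist_comm]
    have := (St.act_isom (t⁻¹ * v)).dist_eq (r₁ • v⁻¹ • x) (v⁻¹ • x)
    simpa [mul_smul] using this
  rw [hzq]
  have := dist_triangle ((t⁻¹ * r₂⁻¹) • x) (t⁻¹ • x) (t⁻¹ • v • r₁ • v⁻¹ • x)
  linarith

end Tree

/-- **Lemma 5.3.**  The admissible lamination of the induced system `𝒦 = (K, 𝒜)` is
contained in the dual lamination of `T`: (i) if `X, Y ∈ ∂F_N` are admissible infinite
words with distinct first letters whose domains intersect, then `𝒬(X) = 𝒬(Y)`, i.e.
`(X,Y) ∈ L²(T)`; consequently (ii) `ℒ_adm(𝒦) ⊆ ℒ_𝒜(T)`. -/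
theorem admissible_subset_dual {ι : Type} [Fintype ι] [DecidableEq ι]
    (hrank : 2 ≤ Fintype.card ι) (St : TreeSetup ι) (K : Set St.Tb)
    (hKcomp : IsCompact K) (hKtree : IsClosedSubtree K)
    (hKa : ∀ i : ι, (K ∩ FreeGroup.of i • K).Nonempty) :
    (∀ X Y : InfWord ι, InducedAdmissibleInf St K X → InducedAdmissibleInf St K Y →
      X.letter 0 ≠ Y.letter 0 → (inducedDomInf St K X ∩ inducedDomInf St K Y).Nonempty →
      ∃ Q : St.Tb, QRel St X Q ∧ QRel St Y Q) ∧
    inducedAdmLanguage St K ⊆ dualLanguageOn ι St.Tsub := by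
  refine ⟨fun X Y _ _ _ ⟨x, hX, hY⟩ =>
    ⟨x, qRel_of_mem_inducedDomInf St hKcomp hX, qRel_of_mem_inducedDomInf St hKcomp hY⟩,
    inducedAdmLanguage_subset_dualLanguageOn St (by rwa [Nat.card_eq_fintype_card]) hKcomp⟩

end CHL
end
end
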